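/- arXiv:1806.07260 — 6 statements merged into one kernel-verified Lean document; each statement's English description precedes it below -/
import Mathlib

section
/- Let G be a finite simple graph whose adjacency spectrum has exactly one entry (counted with multiplicity) different from 2 and −1. Then G is a disjoint union of complete graphs in which all but one connected component is isomorphic to K₃. -/
open SimpleGraph Polynomial

/-- The characteristic polynomial of the adjacency matrix of `G` over `ℝ`. -/
noncomputable def adjCharpoly {V : Type*} [Fintype V] [DecidableEq V]
    (G : SimpleGraph V) : Polynomial ℝ :=
  letI : DecidableRel G.Adj := Classical.decRel _
  Matrix.charpoly (G.adjMatrix ℝ)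

/-- The adjacency spectrum of `G`: the multiset of real eigenvalues (with multiplicity),
i.e. the roots of the characteristic polynomial of its adjacency matrix. -/
noncomputable def adjSpectrum {V : Type*} [Fintype V] [DecidableEq V]
    (G : SimpleGraph V) : Multiset ℝ :=
  (adjCharpoly G).roots

/-- Spectral part: `A² - A - 2` has rank at most one. -/
lemma rank_one_form {V : Type*} [Fintype V] [DecidableEq V] (A : Matrix V V ℝ)
    (hA : A.IsHermitian)
    (h : ((A.charpoly.roots).filter (fun μ => μ ≠ 2 ∧ μ ≠ -1)).card = 1) :
    Nonempty V ∧ ∃ (c : ℝ) (x : V → ℝ), ∀ u v,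
      (A * A - A - (2 : ℝ) • (1 : Matrix V V ℝ)) u v = c * x u * x v := by
  rw [hA.roots_charpoly_eq_eigenvalues, Multiset.filter_map, Multiset.card_map] at h
  obtain ⟨i, hi⟩ := Multiset.card_eq_one.mp h
  refine ⟨⟨i⟩, ?_⟩
  set e := hA.eigenvalues with he
  have hne : ∀ j, j ≠ i → (e j = 2 ∨ e j = -1) := by
    intro j hj
    by_contra hcon
    push Not at hcon
    have : j ∈ Multiset.filter ((fun μ : ℝ => μ ≠ 2 ∧ μ ≠ -1) ∘ (RCLike.ofReal ∘ e))
        Finset.univ.val := by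
      rw [Multiset.mem_filter]
      exact ⟨Finset.mem_univ j, by simpa using hcon⟩
    rw [hi] at this
    exact hj (by simpa using this)
  set U : Matrix V V ℝ := (hA.eigenvectorUnitary : Matrix V V ℝ) with hU
  have hUU : star U * U = 1 := Unitary.coe_star_mul_self _
  have hUU' : U * star U = 1 := Unitary.coe_mul_star_self _
  have hs : A = U * Matrix.diagonal e * star U := by
    have := hA.spectral_theorem
    rw [Unitary.conjStarAlgAut_apply] at this
    exact this
  have hB : A * A - A - (2 : ℝ) • (1 : Matrix V V ℝ) =
      U * Matrix.diagonal (fun j => e j * e j - e j - 2) * star U := by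
    have h1 : A * A = U * Matrix.diagonal (fun j => e j * e j) * star U := by
      calc A * A = U * Matrix.diagonal e * (star U * U) * Matrix.diagonal e * star U := by
            conv_lhs => rw [hs]
            simp only [Matrix.mul_assoc]
        _ = _ := by
            rw [hUU, Matrix.mul_one, Matrix.mul_assoc U, Matrix.diagonal_mul_diagonal]
    have h2 : (2 : ℝ) • (1 : Matrix V V ℝ) =
        U * Matrix.diagonal (fun _ => (2 : ℝ)) * star U := by
      rw [← hUU', show Matrix.diagonal (fun _ : V => (2 : ℝ)) = (2 : ℝ) • (1 : Matrix V V ℝ) by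
        rw [Matrix.smul_one_eq_diagonal]]
      simp
    rw [h1, h2]
    conv_lhs => rw [hs]
    rw [← sub_mul, ← sub_mul, ← mul_sub, ← mul_sub, Matrix.diagonal_sub, Matrix.diagonal_sub]
  refine ⟨e i * e i - e i - 2, fun u => U u i, fun u v => ?_⟩
  rw [hB, Matrix.mul_apply, Finset.sum_eq_single i]
  · rw [Matrix.mul_diagonal]
    simp only [Matrix.star_apply, star_trivial]
    ring
  · intro j _ hj
    rw [Matrix.mul_diagonal]
    rcases hne j hj with h | h <;> rw [h] <;> norm_num
  · simp

section comb

variable {V : Type*} [Fintype V] [DecidableEq V] (G : SimpleGraph V) [DecidableRel G.Adj]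
  (c : ℝ) (x : V → ℝ)

lemma cx_zero
    (hD : ∀ u, c * x u * x u = (G.neighborFinset u).card - 2)
    {u : V} (hu : (G.neighborFinset u).card = 2) : c * x u = 0 := by
  have := hD u
  rw [hu] at this
  have h2 : (c * x u) * x u = 0 := by rw [this]; norm_num
  rcases mul_eq_zero.mp h2 with h | h
  · exact h
  · rw [h, mul_zero]

lemma two_nonadj
    (hD : ∀ u, c * x u * x u = (G.neighborFinset u).card - 2)
    (hN : ∀ u v, u ≠ v → ¬ G.Adj u v →
      c * x u * x v = (G.neighborFinset u ∩ G.neighborFinset v).card)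
    {u v w : V} (hu : (G.neighborFinset u).card = 2) (huv : u ≠ v)
    (h : ¬ G.Adj u v) (h1 : G.Adj u w) (h2 : G.Adj v w) : False := by
  have := hN u v huv h
  rw [cx_zero G c x hD hu, zero_mul] at this
  have h0 : (G.neighborFinset u ∩ G.neighborFinset v).card = 0 := by exact_mod_cast this.symm
  rw [Finset.card_eq_zero] at h0
  have : w ∈ G.neighborFinset u ∩ G.neighborFinset v := by simp [h1, h2]
  rw [h0] at this
  simp at this

lemma two_common
    (hD : ∀ u, c * x u * x u = (G.neighborFinset u).card - 2)
    (hA : ∀ u v, G.Adj u v →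
      c * x u * x v = (G.neighborFinset u ∩ G.neighborFinset v).card - 1)
    {u v : V} (hu : (G.neighborFinset u).card = 2) (h : G.Adj u v) :
    (G.neighborFinset u ∩ G.neighborFinset v).card = 1 := by
  have := hA u v h
  rw [cx_zero G c x hD hu, zero_mul] at this
  have : ((G.neighborFinset u ∩ G.neighborFinset v).card : ℝ) = 1 := by linarith
  exact_mod_cast this

lemma two_mid
    (hD : ∀ u, c * x u * x u = (G.neighborFinset u).card - 2)
    (hA : ∀ u v, G.Adj u v →
      c * x u * x v = (G.neighborFinset u ∩ G.neighborFinset v).card - 1)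
    {u v w : V} (hw : (G.neighborFinset w).card = 2) (hu : G.Adj w u)
    (hv : G.Adj w v) (huv : u ≠ v) : G.Adj u v := by
  obtain ⟨t, ht⟩ := Finset.card_eq_one.mp (two_common G c x hD hA hw hu)
  have ht' : t ∈ G.neighborFinset w ∩ G.neighborFinset u := by rw [ht]; simp
  simp only [Finset.mem_inter, mem_neighborFinset] at ht'
  by_cases htv : t = v
  · exact htv ▸ ht'.2
  exfalso
  have hsub : ({u, v, t} : Finset V) ⊆ G.neighborFinset w := by
    intro a ha
    simp only [Finset.mem_insert, Finset.mem_singleton] at ha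
    rcases ha with rfl | rfl | rfl <;> simp [*]
  have := Finset.card_le_card hsub
  rw [hw, Finset.card_eq_three.mpr ⟨u, v, t, huv, ht'.2.ne, Ne.symm htv, rfl⟩] at this
  omega

lemma common_lt {u w : V} (h : G.Adj u w) :
    (G.neighborFinset u ∩ G.neighborFinset w).card + 1 ≤ (G.neighborFinset w).card := by
  have hsub : insert u (G.neighborFinset u ∩ G.neighborFinset w) ⊆ G.neighborFinset w := by
    intro a ha
    simp only [Finset.mem_insert, Finset.mem_inter, mem_neighborFinset] at ha ⊢
    rcases ha with rfl | ha
    · exact h.symm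
    · exact ha.2
  have := Finset.card_le_card hsub
  rwa [Finset.card_insert_of_notMem (by simp)] at this

lemma same_sign
    (hD : ∀ u, c * x u * x u = (G.neighborFinset u).card - 2)
    (hA : ∀ u v, G.Adj u v →
      c * x u * x v = (G.neighborFinset u ∩ G.neighborFinset v).card - 1)
    {u v w : V} (hc : 0 < c) (hu : G.Adj u w) (hv : G.Adj w v) (huv : u ≠ v)
    (hs : 0 < x u * x w) : G.Adj u v := by
  have h1 := hA u w hu
  have hdu := hD u
  have hdw := hD w
  have hpos : 0 < c * x u * x w := by rw [mul_assoc]; exact mul_pos hc hs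
  have hl1 := common_lt G hu
  have hl2 := common_lt G hu.symm
  rw [Finset.inter_comm] at hl2
  have hl1' : ((G.neighborFinset u ∩ G.neighborFinset w).card : ℝ) + 1
      ≤ (G.neighborFinset w).card := by exact_mod_cast hl1
  have hl2' : ((G.neighborFinset u ∩ G.neighborFinset w).card : ℝ) + 1
      ≤ (G.neighborFinset u).card := by exact_mod_cast hl2
  have hprod : (c * x u * x w) * (c * x u * x w) = (c * x u * x u) * (c * x w * x w) := by ring
  have heq : (G.neighborFinset w).card = (G.neighborFinset u ∩ G.neighborFinset w).card + 1 := by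
    by_contra hne
    have hlt : ((G.neighborFinset u ∩ G.neighborFinset w).card : ℝ) + 1
      < (G.neighborFinset w).card := by exact_mod_cast lt_of_le_of_ne hl1 (Ne.symm hne)
    have a1 : c * x u * x w < c * x w * x w := by linarith
    have a2 : c * x u * x w ≤ c * x u * x u := by linarith
    nlinarith
  have hins : insert u (G.neighborFinset u ∩ G.neighborFinset w) = G.neighborFinset w := by
    apply Finset.eq_of_subset_of_card_le
    · intro a ha
      simp only [Finset.mem_insert, Finset.mem_inter, mem_neighborFinset] at ha ⊢
      rcases ha with rfl | ha
      · exact hu.symm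
      · exact ha.2
    · rw [Finset.card_insert_of_notMem (by simp), heq]
  have hvm : v ∈ insert u (G.neighborFinset u ∩ G.neighborFinset w) := by
    rw [hins]; simpa using hv
  simp only [Finset.mem_insert, Finset.mem_inter, mem_neighborFinset] at hvm
  rcases hvm with h | h
  · exact absurd h.symm huv
  · exact h.1

lemma opp_sign
    (hA : ∀ u v, G.Adj u v →
      c * x u * x v = (G.neighborFinset u ∩ G.neighborFinset v).card - 1)
    (hN : ∀ u v, u ≠ v → ¬ G.Adj u v →
      c * x u * x v = (G.neighborFinset u ∩ G.neighborFinset v).card)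
    {u v : V} (hc : 0 < c) (hs : x u * x v < 0) :
    G.Adj u v ∧ (G.neighborFinset u ∩ G.neighborFinset v).card = 0 := by
  have hneg : c * x u * x v < 0 := by rw [mul_assoc]; exact mul_neg_of_pos_of_neg hc hs
  have hne : u ≠ v := by
    rintro rfl
    nlinarith [mul_self_nonneg (x u)]
  by_cases h : G.Adj u v
  · refine ⟨h, ?_⟩
    have h1 := hA u v h
    have : ((G.neighborFinset u ∩ G.neighborFinset v).card : ℝ) < 1 := by linarith
    have : (G.neighborFinset u ∩ G.neighborFinset v).card < 1 := by exact_mod_cast this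
    omega
  · have h1 := hN u v hne h
    have : (0 : ℝ) ≤ (G.neighborFinset u ∩ G.neighborFinset v).card := Nat.cast_nonneg _
    linarith

lemma key_adj
    (hD : ∀ u, c * x u * x u = (G.neighborFinset u).card - 2)
    (hA : ∀ u v, G.Adj u v →
      c * x u * x v = (G.neighborFinset u ∩ G.neighborFinset v).card - 1)
    (hN : ∀ u v, u ≠ v → ¬ G.Adj u v →
      c * x u * x v = (G.neighborFinset u ∩ G.neighborFinset v).card)
    {u v : V} (hu : (G.neighborFinset u).card ≠ 2)
    (hv : (G.neighborFinset v).card ≠ 2) (huv : u ≠ v) : G.Adj u v := by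
  by_contra hn
  have hO := hN u v huv hn
  have hdu := hD u
  have hdv := hD v
  have hprod : (c * x u * x v) * (c * x u * x v) = (c * x u * x u) * (c * x v * x v) := by ring
  have hu' : ((G.neighborFinset u).card : ℝ) ≠ 2 := by exact_mod_cast hu
  have hv' : ((G.neighborFinset v).card : ℝ) ≠ 2 := by exact_mod_cast hv
  have hne : c * x u * x v ≠ 0 := by
    intro h0
    rw [h0, hdu, hdv, mul_zero, eq_comm, mul_eq_zero, sub_eq_zero, sub_eq_zero] at hprod
    tauto
  have hpos : 0 < c * x u * x v := by
    apply lt_of_le_of_ne _ (Ne.symm hne)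
    rw [hO]; exact Nat.cast_nonneg _
  have hcard : 0 < (G.neighborFinset u ∩ G.neighborFinset v).card := by
    rw [hO] at hpos; exact_mod_cast hpos
  obtain ⟨w, hw⟩ := Finset.card_pos.mp hcard
  simp only [Finset.mem_inter, mem_neighborFinset] at hw
  obtain ⟨huw, hvw⟩ := hw
  by_cases hw2 : (G.neighborFinset w).card = 2
  · exact hn (two_mid G c x hD hA hw2 huw.symm hvw.symm huv)
  rcases lt_trichotomy c 0 with hc | hc | hc
  · -- `w` has degree at least two, hence exactly two
    have hsub : ({u, v} : Finset V) ⊆ G.neighborFinset w := by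
      intro a ha
      simp only [Finset.mem_insert, Finset.mem_singleton] at ha
      rcases ha with rfl | rfl
      · simpa using huw.symm
      · simpa using hvw.symm
    have h1 := Finset.card_le_card hsub
    rw [Finset.card_pair huv] at h1
    have h2 : c * x w * x w ≤ 0 := by nlinarith [mul_self_nonneg (x w)]
    rw [hD w] at h2
    have h3 : ((G.neighborFinset w).card : ℝ) ≤ 2 := by linarith
    have h4 : (G.neighborFinset w).card ≤ 2 := by exact_mod_cast h3
    omega
  · rw [hc] at hne; simp at hne
  · have hsuv : 0 < x u * x v := by
      rw [mul_assoc] at hpos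
      exact (mul_pos_iff_of_pos_left hc).mp hpos
    have hw2' : ((G.neighborFinset w).card : ℝ) ≠ 2 := by exact_mod_cast hw2
    have hdw := hD w
    have hxw : x w ≠ 0 := by
      intro h0
      rw [h0, mul_zero, eq_comm, sub_eq_zero] at hdw
      exact hw2' hdw
    have hxu : x u ≠ 0 := by
      intro h0
      rw [h0, zero_mul] at hsuv
      exact lt_irrefl _ hsuv
    rcases lt_or_gt_of_ne (mul_ne_zero hxu hxw) with hs | hs
    swap
    · exact hn (same_sign G c x hD hA hc huw hvw.symm huv hs)
    have hsv : x v * x w < 0 := by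
      by_contra hcon
      push Not at hcon
      have : 0 < x w * x w := mul_self_pos.mpr hxw
      nlinarith [mul_pos hsuv this]
    obtain ⟨_, hcuw⟩ := opp_sign G c x hA hN hc hs
    obtain ⟨_, hcvw⟩ := opp_sign G c x hA hN hc hsv
    have huw1 := hA u w huw
    have hvw1 := hA v w hvw
    rw [hcuw] at huw1
    rw [hcvw] at hvw1
    have hp1 : (c * x u * x w) * (c * x u * x w) = (c * x u * x u) * (c * x w * x w) := by ring
    have hp2 : (c * x v * x w) * (c * x v * x w) = (c * x v * x v) * (c * x w * x w) := by ring
    have hp3 : (c * x u * x w) * (c * x v * x w) = (c * x u * x v) * (c * x w * x w) := by ring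
    -- degrees are at least three
    have hge : ∀ a, x a ≠ 0 → 3 ≤ (G.neighborFinset a).card := by
      intro a ha
      have h1 : 0 < c * x a * x a := by
        rw [mul_assoc]; exact mul_pos hc (mul_self_pos.mpr ha)
      rw [hD a] at h1
      have : (2 : ℝ) < (G.neighborFinset a).card := by linarith
      have : 2 < (G.neighborFinset a).card := by exact_mod_cast this
      omega
    have hgu := hge u hxu
    have hgw := hge w hxw
    have hgw' : (3 : ℝ) ≤ (G.neighborFinset w).card := by exact_mod_cast hgw
    have huv1 : (G.neighborFinset u ∩ G.neighborFinset v).card ≤ 1 := by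
      rw [huw1, hvw1, hO, hdw] at hp3
      have : ((G.neighborFinset u ∩ G.neighborFinset v).card : ℝ) ≤ 1 := by
        push_cast at hp3
        nlinarith
      exact_mod_cast this
    obtain ⟨a, ha, haw⟩ := Finset.exists_mem_ne (by omega : 1 < (G.neighborFinset u).card) w
    rw [mem_neighborFinset] at ha
    have hnaw : ¬ G.Adj a w := by
      intro h
      rw [Finset.card_eq_zero] at hcuw
      have : a ∈ G.neighborFinset u ∩ G.neighborFinset w := by simp [ha, h.symm]
      rw [hcuw] at this
      simp at this
    rcases lt_trichotomy (x a * x w) 0 with hsa | hsa | hsa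
    · exact hnaw (opp_sign G c x hA hN hc hsa).1
    · have h1 := hN a w haw hnaw
      rw [mul_assoc, hsa, mul_zero] at h1
      have h0 : (G.neighborFinset a ∩ G.neighborFinset w).card = 0 := by exact_mod_cast h1.symm
      rw [Finset.card_eq_zero] at h0
      have : u ∈ G.neighborFinset a ∩ G.neighborFinset w := by simp [ha.symm, huw.symm]
      rw [h0] at this
      simp at this
    · have hav : x a * x v < 0 := by
        by_contra hcon
        push Not at hcon
        have : 0 < x w * x w := mul_self_pos.mpr hxw
        nlinarith [mul_neg_of_pos_of_neg hsa hsv]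
      have hadj := (opp_sign G c x hA hN hc hav).1
      have := Finset.card_le_one.mp huv1 a (by simp [ha, hadj.symm]) w (by simp [huw, hvw])
      exact haw this

lemma adj_trans
    (hD : ∀ u, c * x u * x u = (G.neighborFinset u).card - 2)
    (hA : ∀ u v, G.Adj u v →
      c * x u * x v = (G.neighborFinset u ∩ G.neighborFinset v).card - 1)
    (hN : ∀ u v, u ≠ v → ¬ G.Adj u v →
      c * x u * x v = (G.neighborFinset u ∩ G.neighborFinset v).card)
    {u v w : V} (h1 : G.Adj u w) (h2 : G.Adj w v) (huv : u ≠ v) : G.Adj u v := by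
  by_contra hn
  by_cases hu : (G.neighborFinset u).card = 2
  · exact two_nonadj G c x hD hN hu huv hn h1 h2.symm
  by_cases hv : (G.neighborFinset v).card = 2
  · exact two_nonadj G c x hD hN hv huv.symm (fun h => hn h.symm) h2.symm h1
  exact hn (key_adj G c x hD hA hN hu hv huv)

lemma comp_adj
    (hD : ∀ u, c * x u * x u = (G.neighborFinset u).card - 2)
    (hA : ∀ u v, G.Adj u v →
      c * x u * x v = (G.neighborFinset u ∩ G.neighborFinset v).card - 1)
    (hN : ∀ u v, u ≠ v → ¬ G.Adj u v →
      c * x u * x v = (G.neighborFinset u ∩ G.neighborFinset v).card)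
    {u v : V} (huv : u ≠ v)
    (h : G.connectedComponentMk u = G.connectedComponentMk v) : G.Adj u v := by
  obtain ⟨p⟩ := ConnectedComponent.exact h
  have : u = v ∨ G.Adj u v := by
    clear huv h
    induction p with
    | nil => exact Or.inl rfl
    | @cons a b d hab _ ih =>
      by_cases had : a = d
      · exact Or.inl had
      · rcases ih with rfl | ih
        · exact Or.inr hab
        · exact Or.inr (adj_trans G c x hD hA hN hab ih had)
  exact this.resolve_left huv

lemma final_comb
    (hD : ∀ u, c * x u * x u = (G.neighborFinset u).card - 2)
    (hA : ∀ u v, G.Adj u v →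
      c * x u * x v = (G.neighborFinset u ∩ G.neighborFinset v).card - 1)
    (hN : ∀ u v, u ≠ v → ¬ G.Adj u v →
      c * x u * x v = (G.neighborFinset u ∩ G.neighborFinset v).card)
    [Nonempty V] :
    (∀ u v : V, u ≠ v → G.connectedComponentMk u = G.connectedComponentMk v → G.Adj u v) ∧
    ∃ c : G.ConnectedComponent, ∀ c' : G.ConnectedComponent, c' ≠ c → c'.supp.ncard = 3 := by
  refine ⟨fun u v huv h => comp_adj G c x hD hA hN huv h, ?_⟩
  have hthree : ∀ u, (G.neighborFinset u).card = 2 →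
      (G.connectedComponentMk u).supp.ncard = 3 := by
    intro u hu
    have : (G.connectedComponentMk u).supp = ((insert u (G.neighborFinset u) : Finset V) : Set V) := by
      ext a
      simp only [ConnectedComponent.mem_supp_iff, Finset.mem_coe, Finset.mem_insert,
        mem_neighborFinset]
      constructor
      · intro h
        by_cases hau : a = u
        · exact Or.inl hau
        · exact Or.inr (comp_adj G c x hD hA hN hau h).symm
      · rintro (rfl | h)
        · rfl
        · exact ConnectedComponent.sound h.symm.reachable
    rw [this, Set.ncard_coe_finset, Finset.card_insert_of_notMem (by simp), hu]
  by_cases hex : ∃ u, (G.neighborFinset u).card ≠ 2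
  · obtain ⟨u, hu⟩ := hex
    refine ⟨G.connectedComponentMk u, fun c' hc' => ?_⟩
    induction c' using ConnectedComponent.ind with
    | h v =>
      apply hthree
      by_contra hv
      have huv : v ≠ u := by rintro rfl; exact hc' rfl
      exact hc' (ConnectedComponent.sound (key_adj G c x hD hA hN hv hu huv).reachable)
  · push Not at hex
    refine ⟨G.connectedComponentMk (Classical.arbitrary V), fun c' _ => ?_⟩
    induction c' using ConnectedComponent.ind with
    | h v => exact hthree v (hex v)

end comb

/-- If the adjacency spectrum of a finite simple graph has exactly one entry (with
multiplicity) different from `2` and `-1`, then the graph is a disjoint union of complete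
graphs (every connected component is complete) in which all but one connected component is
isomorphic to `K₃` (i.e. has exactly `3` vertices). -/
theorem one_eigenvalue_not_two_or_neg_one {V : Type*} [Fintype V] [DecidableEq V]
    (G : SimpleGraph V)
    (h : ((adjSpectrum G).filter (fun μ => μ ≠ 2 ∧ μ ≠ -1)).card = 1) :
    (∀ u v : V, u ≠ v → G.connectedComponentMk u = G.connectedComponentMk v → G.Adj u v) ∧
    ∃ c : G.ConnectedComponent, ∀ c' : G.ConnectedComponent, c' ≠ c → c'.supp.ncard = 3 := by
  classical
  letI : DecidableRel G.Adj := Classical.decRel _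
  have hherm : (G.adjMatrix ℝ).IsHermitian := by
    rw [Matrix.IsHermitian, Matrix.conjTranspose_eq_transpose_of_trivial]
    exact G.isSymm_adjMatrix
  obtain ⟨hne, c, x, hB⟩ := rank_one_form (G.adjMatrix ℝ) hherm h
  have hsq : ∀ u v, (G.adjMatrix ℝ * G.adjMatrix ℝ) u v =
      (G.neighborFinset u ∩ G.neighborFinset v).card := by
    intro u v
    rw [adjMatrix_mul_apply]
    simp only [adjMatrix_apply]
    rw [Finset.sum_boole, ← Finset.filter_mem_eq_inter]
    simp [adj_comm]
  refine final_comb G c x ?_ ?_ ?_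
  · intro u
    rw [← hB u u, Matrix.sub_apply, Matrix.sub_apply, hsq]
    simp
  · intro u v huv
    rw [← hB u v, Matrix.sub_apply, Matrix.sub_apply, hsq]
    simp [huv, huv.ne]
  · intro u v hne huv
    rw [← hB u v, Matrix.sub_apply, Matrix.sub_apply, hsq]
    simp [huv, hne]
end

section
/- Let G be a finite simple graph whose adjacency spectrum has exactly two entries r and s with r ≥ s (counted with multiplicity) different from 2 and −1. Then either r > 2 and s < −1, or G is a disjoint union of complete graphs exactly two of whose connected components are not isomorphic to K₃. -/
open SimpleGraph Polynomial

section core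
set_option linter.unusedSectionVars false
variable {V : Type*} [Fintype V] [DecidableEq V] (G : SimpleGraph V) [DecidableRel G.Adj]

def cmn (i j : V) : ℕ := (G.neighborFinset i ∩ G.neighborFinset j).card

lemma sq_apply (i j : V) : (G.adjMatrix ℝ * G.adjMatrix ℝ) i j = (cmn G i j : ℝ) := by
  rw [SimpleGraph.adjMatrix_mul_apply, cmn]
  simp only [SimpleGraph.adjMatrix_apply, Finset.sum_boole]
  congr 2
  ext k
  simp [G.adj_comm]

lemma cmn_self (i : V) : cmn G i i = G.degree i := by simp [cmn]

lemma nbr_one {p q : V} (h : G.degree p = 1) (hq : G.Adj p q) {j : V} (hj : G.Adj p j) : j = q := by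
  rw [← SimpleGraph.card_neighborFinset_eq_degree, Finset.card_eq_one] at h
  obtain ⟨a, ha⟩ := h
  have h1 : j ∈ G.neighborFinset p := by simpa using hj
  have h2 : q ∈ G.neighborFinset p := by simpa using hq
  rw [ha] at h1 h2
  simp at h1 h2
  rw [h1, h2]

lemma nbr_two {p q r : V} (h : G.degree p = 2) (hq : G.Adj p q) (hr : G.Adj p r) (hqr : q ≠ r)
    {j : V} (hj : G.Adj p j) : j = q ∨ j = r := by
  rw [← SimpleGraph.card_neighborFinset_eq_degree] at h
  have hs : ({q, r} : Finset V) = G.neighborFinset p := by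
    apply Finset.eq_of_subset_of_card_le
    · intro x hx
      simp at hx
      rcases hx with rfl | rfl <;> simpa
    · rw [h, Finset.card_pair hqr]
  have h1 : j ∈ G.neighborFinset p := by simpa using hj
  rw [← hs] at h1
  simpa using h1

lemma cmn_zero {i j : V} (h : ∀ k, G.Adj i k → ¬ G.Adj j k) : cmn G i j = 0 := by
  rw [cmn, Finset.card_eq_zero, Finset.eq_empty_iff_forall_notMem]
  intro k hk
  simp at hk
  exact h k hk.1 hk.2

lemma closed_two (hP : ∀ x : V → ℝ, ∑ i, x i * ∑ j ∈ G.neighborFinset i, x j ≤ 2 * ∑ i, x i ^ 2)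
    (S : Finset V) (hS : ∀ i ∈ S, ∀ j, G.Adj i j → j ∈ S) (hd : ∀ i ∈ S, 2 ≤ G.degree i) :
    ∀ i ∈ S, G.degree i = 2 := by
  have h := hP (fun i => if i ∈ S then 1 else 0)
  have h1 : ∀ i, (if i ∈ S then (1:ℝ) else 0) * ∑ j ∈ G.neighborFinset i, (if j ∈ S then (1:ℝ) else 0)
      = if i ∈ S then (G.degree i : ℝ) else 0 := by
    intro i
    split_ifs with hi
    · rw [one_mul, Finset.sum_congr rfl (g := fun _ => (1:ℝ))]
      · simp
      · intro j hj
        rw [if_pos (hS i hi j (by simpa using hj))]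
    · simp
  simp only [h1] at h
  simp at h
  have h2 : ∑ i ∈ S, ((G.degree i : ℝ) - 2) ≤ 0 := by
    rw [Finset.sum_sub_distrib]; simp; linarith
  have h3 : ∀ i ∈ S, 0 ≤ (G.degree i : ℝ) - 2 := by
    intro i hi
    have : (2:ℝ) ≤ G.degree i := by exact_mod_cast hd i hi
    linarith
  have h4 := (Finset.sum_eq_zero_iff_of_nonneg h3).1 (le_antisymm h2 (Finset.sum_nonneg h3))
  intro i hi
  have := h4 i hi
  have h5 : (G.degree i : ℝ) = 2 := by linarith
  exact_mod_cast h5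

lemma leaf_two (hP : ∀ x : V → ℝ, ∑ i, x i * ∑ j ∈ G.neighborFinset i, x j ≤ 2 * ∑ i, x i ^ 2)
    (p : V) (hp : G.degree p = 1) (hd : ∀ i, i ≠ p → 2 ≤ G.degree i) :
    ∀ i, i ≠ p → G.degree i = 2 := by
  have h := hP (fun i => 2 - if i = p then 1 else 0)
  have e1 : ∀ i, ∑ j ∈ G.neighborFinset i, ((2:ℝ) - if j = p then 1 else 0)
      = 2 * G.degree i - if G.Adj p i then 1 else 0 := by
    intro i
    rw [Finset.sum_sub_distrib]
    simp [G.adj_comm, mul_comm]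
  simp only [e1] at h
  have e2 : ∑ i, ((2:ℝ) - if i = p then 1 else 0) * (2 * G.degree i - if G.Adj p i then 1 else 0)
      = 4 * ∑ i, (G.degree i : ℝ) - 4 := by
    have : ∀ i, ((2:ℝ) - if i = p then 1 else 0) * (2 * G.degree i - if G.Adj p i then 1 else 0)
      = 4 * G.degree i - 2 * (if G.Adj p i then 1 else 0) - (if i = p then 2 * (G.degree p:ℝ) else 0) := by
      intro i
      by_cases hi : i = p
      · subst hi; simp; ring
      · simp only [hi, if_false]; ring
    simp only [this, Finset.sum_sub_distrib, ← Finset.mul_sum, Finset.sum_boole]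
    have : (Finset.univ.filter (fun i => G.Adj p i)).card = 1 := by
      rw [← hp, ← SimpleGraph.card_neighborFinset_eq_degree]; congr 1; ext; simp
    rw [this]; simp [hp]; ring
  have e3 : ∑ i, ((2:ℝ) - if i = p then 1 else 0) ^ 2 = 4 * (Fintype.card V : ℝ) - 3 := by
    have : ∀ i, ((2:ℝ) - if i = p then 1 else 0) ^ 2 = 4 - if i = p then 3 else 0 := by
      intro i; split_ifs <;> norm_num
    simp only [this, Finset.sum_sub_distrib]; simp [mul_comm]
  rw [e2, e3] at h
  have hs := Finset.add_sum_erase Finset.univ (fun i => (G.degree i : ℝ) - 2) (Finset.mem_univ p)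
  have hsum : ∑ i, ((G.degree i : ℝ) - 2) = ∑ i, (G.degree i : ℝ) - 2 * (Fintype.card V : ℝ) := by
    rw [Finset.sum_sub_distrib]; simp [mul_comm]
  rw [hsum, hp] at hs
  have h3 : ∀ i ∈ Finset.univ.erase p, 0 ≤ (G.degree i : ℝ) - 2 := by
    intro i hi
    have : (2:ℝ) ≤ G.degree i := by exact_mod_cast hd i (by simpa using hi)
    linarith
  intro i hi
  have h5 := Finset.single_le_sum h3 (show i ∈ Finset.univ.erase p by simpa using hi)
  push_cast at hs
  have h6 : (G.degree i : ℝ) < 3 := by linarith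
  have h7 : G.degree i < 3 := by exact_mod_cast h6
  have := hd i hi
  omega

theorem core (a b : ℝ) (hb : 0 < b) (f w : V → ℝ)
    (hM : ∀ i j, (cmn G i j : ℝ) - (if G.Adj i j then 1 else 0) - (if i = j then 2 else 0)
      = - a * (f i * f j) + b * (w i * w j))
    (hP : ∀ x : V → ℝ, ∑ i, x i * ∑ j ∈ G.neighborFinset i, x j ≤ 2 * ∑ i, x i ^ 2)
    (v₁ v₀ v₂ : V) (h1 : G.Adj v₀ v₁) (h2 : G.Adj v₀ v₂) (hne : v₁ ≠ v₂) (hna : ¬ G.Adj v₁ v₂) :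
    False := by
  set m : V → V → ℝ := fun i j => - a * (f i * f j) + b * (w i * w j) with hm
  have hdet : ∀ i j k, m i i * (m j j * m k k - m j k ^ 2) - m i j * (m i j * m k k - m j k * m i k)
      + m i k * (m i j * m j k - m j j * m i k) = 0 := by
    intro i j k; simp only [hm]; ring
  have hdiag : ∀ i, m i i = (G.degree i : ℝ) - 2 := by
    intro i; have := hM i i; rw [cmn_self] at this; simp only [hm, ← this]; simp
  have hadj : ∀ i j, G.Adj i j → m i j = (cmn G i j : ℝ) - 1 := by
    intro i j h; simp only [hm, ← hM i j]; simp [h, h.ne]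
  have hnadj : ∀ i j, i ≠ j → ¬ G.Adj i j → m i j = (cmn G i j : ℝ) := by
    intro i j h h'; simp only [hm, ← hM i j]; simp [h, h']
  have triple : G.degree v₁ = 2 → G.degree v₀ = 2 → G.degree v₂ = 2 → False := by
    intro d1 d0 d2
    have c1 : cmn G v₀ v₁ = 0 := by
      apply cmn_zero
      intro k hk hk'
      rcases nbr_two G d0 h1 h2 hne hk with rfl | rfl
      · exact hk'.ne rfl
      · exact hna hk'
    have c2 : cmn G v₀ v₂ = 0 := by
      apply cmn_zero
      intro k hk hk'
      rcases nbr_two G d0 h1 h2 hne hk with rfl | rfl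
      · exact hna hk'.symm
      · exact hk'.ne rfl
    have c3 : 0 < cmn G v₁ v₂ := by
      rw [cmn, Finset.card_pos]
      exact ⟨v₀, by simp [h1.symm, h2.symm]⟩
    have c3' : (0:ℝ) < cmn G v₁ v₂ := by exact_mod_cast c3
    have := hdet v₀ v₁ v₂
    rw [hdiag, hdiag, hdiag, hadj _ _ h1, hadj _ _ h2, hnadj _ _ hne hna, d0, d1, d2, c1, c2] at this
    push_cast at this
    nlinarith
  by_cases hall : ∀ i, 2 ≤ G.degree i
  · have := closed_two G hP Finset.univ (by simp) (by simpa using hall)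
    exact triple (this _ (by simp)) (this _ (by simp)) (this _ (by simp))
  push Not at hall
  obtain ⟨p, hp⟩ := hall
  have hpR : m p p < 0 := by
    have : (G.degree p : ℝ) < 2 := by exact_mod_cast hp
    rw [hdiag]; linarith
  have ha : 0 < a := by
    by_contra hn
    have : 0 ≤ m p p := by
      simp only [hm]
      have := mul_nonneg (by linarith : 0 ≤ -a) (mul_self_nonneg (f p))
      have := mul_nonneg hb.le (mul_self_nonneg (w p))
      linarith
    linarith
  have hrev : ∀ i j, m i i * m j j ≤ m i j ^ 2 := by
    intro i j
    have : m i j ^ 2 - m i i * m j j = a * b * (f i * w j - f j * w i) ^ 2 := by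
      simp only [hm]; ring
    have h2 : 0 ≤ a * b * (f i * w j - f j * w i) ^ 2 := by positivity
    linarith
  have hz : ∀ j, m p j = 0 → 2 ≤ G.degree j := by
    intro j hj
    have := hrev p j
    rw [hj] at this
    have h0 : 0 ≤ m j j := by
      by_contra hc
      push Not at hc
      nlinarith [mul_pos_of_neg_of_neg hpR hc]
    rw [hdiag] at h0
    have : (2:ℝ) ≤ G.degree j := by linarith
    exact_mod_cast this
  have d0pos : 2 ≤ G.degree v₀ := by
    rw [← SimpleGraph.card_neighborFinset_eq_degree, ← Finset.card_pair hne]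
    apply Finset.card_le_card
    intro x hx
    simp at hx
    rcases hx with rfl | rfl <;> simpa
  by_cases hp0 : G.degree p = 0
  · have hno : ∀ j, ¬ G.Adj p j := by
      intro j hj
      have := (G.degree_pos_iff_exists_adj p).2 ⟨j, hj⟩
      omega
    have := closed_two G hP (Finset.univ.erase p) (by
        intro i _ j hij
        simp
        rintro rfl
        exact hno _ hij.symm) (by
        intro i hi
        apply hz
        rw [hnadj _ _ (by simp at hi; exact Ne.symm hi) (hno i), cmn_zero G (fun k hk => absurd hk (hno k))]
        simp)
    refine triple (this _ ?_) (this _ ?_) (this _ ?_) <;> simp <;> rintro rfl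
    · exact hno _ h1.symm
    · exact hno _ h1
    · exact hno _ h2.symm
  have hp1 : G.degree p = 1 := by omega
  obtain ⟨q, hq⟩ := (G.degree_pos_iff_exists_adj p).1 (by omega)
  have honly : ∀ j, G.Adj p j → j = q := fun j hj => nbr_one G hp1 hq hj
  have hfar : ∀ j, j ≠ p → j ≠ q → ¬ G.Adj q j → 2 ≤ G.degree j := by
    intro j hjp hjq hj
    apply hz
    rw [hnadj _ _ hjp.symm (fun h => hjq (honly j h)), cmn_zero]
    · simp
    · intro k hk hk'
      rw [honly k hk] at hk'
      exact hj hk'.symm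
  by_cases hq1 : G.degree q = 1
  · have hqonly : ∀ j, G.Adj q j → j = p := fun j hj => nbr_one G hq1 hq.symm hj
    have := closed_two G hP ((Finset.univ.erase p).erase q) (by
        intro i hi j hij
        simp at hi ⊢
        constructor
        · rintro rfl
          exact hi.2 (hqonly _ hij.symm)
        · rintro rfl
          exact hi.1 (honly _ hij.symm)) (by
        intro i hi
        simp at hi
        exact hfar i hi.2 hi.1 (fun h => hi.2 (hqonly _ h)))
    refine triple (this _ ?_) (this _ ?_) (this _ ?_) <;> simp <;> constructor <;> rintro rfl
    · rw [hqonly _ h1.symm] at d0pos; omega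
    · rw [honly _ h1.symm] at d0pos; omega
    · omega
    · omega
    · rw [hqonly _ h2.symm] at d0pos; omega
    · rw [honly _ h2.symm] at d0pos; omega
  have hqpos := (G.degree_pos_iff_exists_adj q).2 ⟨p, hq.symm⟩
  have hnb : ∀ u, G.Adj q u → u ≠ p →
      ((G.degree q : ℝ) - 1) * (G.degree u - 1) = ((cmn G q u : ℝ) - 2) ^ 2 := by
    intro u hu hup
    have hpu : ¬ G.Adj p u := fun h => hu.ne (honly u h).symm
    have c1 : cmn G p q = 0 := by
      apply cmn_zero
      intro k hk
      rw [honly k hk]; exact G.loopless.irrefl q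
    have c2 : cmn G p u = 1 := by
      rw [cmn, Finset.card_eq_one]
      refine ⟨q, ?_⟩
      ext k
      simp
      constructor
      · rintro ⟨h, _⟩; exact honly k h
      · rintro rfl; exact ⟨hq, hu.symm⟩
    have := hdet p q u
    rw [hdiag, hdiag, hdiag, hadj _ _ hq, hadj _ _ hu, hnadj _ _ hup.symm hpu, c1, c2, hp1] at this
    push_cast at this
    linarith
  have hge : ∀ j, j ≠ p → 2 ≤ G.degree j := by
    intro j hjp
    by_cases hjq : j = q
    · subst hjq; omega
    by_cases hj : G.Adj q j
    · have := hnb j hj hjp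
      have hpos := (G.degree_pos_iff_exists_adj j).2 ⟨q, hj.symm⟩
      by_contra hc
      have hj1 : G.degree j = 1 := by omega
      have c : cmn G q j = 0 := by
        apply cmn_zero
        intro k hk hk'
        rw [nbr_one G hj1 hj.symm hk'] at hk
        exact hk.ne rfl
      rw [hj1, c] at this
      norm_num at this
    · exact hfar j hjp hjq hj
  have h22 := leaf_two G hP p hp1 hge
  have dq := h22 q hq.ne'
  obtain ⟨u, hu, hup⟩ : ∃ u, G.Adj q u ∧ u ≠ p := by
    by_contra hc
    push Not at hc
    have : G.neighborFinset q ⊆ {p} := by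
      intro x hx
      simp at hx ⊢
      exact hc x hx
    have := Finset.card_le_card this
    simp at this
    omega
  have := hnb u hu hup
  have c : cmn G q u = 0 := by
    apply cmn_zero
    intro k hk hk'
    rcases nbr_two G dq hq.symm hu hup.symm hk with rfl | rfl
    · exact hu.ne (honly u hk'.symm).symm
    · exact hk'.ne rfl
  rw [dq, h22 u hup, c] at this
  norm_num at this
end core

section spectral
set_option linter.unusedSectionVars false
variable {V : Type*} [Fintype V] [DecidableEq V]

lemma spec_exists {A : Matrix V V ℝ} (hA : A.IsHermitian) :
    ∃ U : Matrix V V ℝ, U * U.transpose = 1 ∧ U.transpose * U = 1 ∧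
      A = U * Matrix.diagonal hA.eigenvalues * U.transpose := by
  refine ⟨hA.eigenvectorUnitary, ?_, ?_, ?_⟩
  · have := Unitary.coe_mul_star_self hA.eigenvectorUnitary
    simpa [Matrix.star_eq_conjTranspose] using this
  · have := Unitary.coe_star_mul_self hA.eigenvectorUnitary
    simpa [Matrix.star_eq_conjTranspose] using this
  · have := hA.spectral_theorem
    rw [Unitary.conjStarAlgAut_apply] at this
    simpa [Matrix.star_eq_conjTranspose, Function.comp_def] using this

lemma conj_diag_apply (U : Matrix V V ℝ) (d : V → ℝ) (i j : V) :
    (U * Matrix.diagonal d * U.transpose) i j = ∑ k, d k * (U i k * U j k) := by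
  rw [Matrix.mul_apply]
  apply Finset.sum_congr rfl
  intro k _
  rw [Matrix.mul_diagonal, Matrix.transpose_apply]
  ring

lemma conj_diag_quad (U : Matrix V V ℝ) (d : V → ℝ) (x : V → ℝ) :
    ∑ i, x i * ∑ j, (U * Matrix.diagonal d * U.transpose) i j * x j
      = ∑ k, d k * (∑ i, x i * U i k) ^ 2 := by
  simp only [conj_diag_apply, Finset.sum_mul, Finset.mul_sum, sq]
  have : ∀ i, ∑ j, ∑ k, x i * (d k * (U i k * U j k) * x j)
      = ∑ k, ∑ j, x i * (d k * (U i k * U j k) * x j) := fun i => Finset.sum_comm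
  simp only [this]
  rw [Finset.sum_comm]
  apply Finset.sum_congr rfl
  intro k _
  rw [Finset.sum_comm]
  apply Finset.sum_congr rfl
  intro j _
  apply Finset.sum_congr rfl
  intro i _
  ring

lemma pair_of_filter (e : V → ℝ) (r s : ℝ)
    (h : (Multiset.map e Finset.univ.val).filter (fun μ => μ ≠ 2 ∧ μ ≠ -1) = {r, s}) :
    ∃ i j, i ≠ j ∧ e i = r ∧ e j = s ∧ (e i ≠ 2 ∧ e i ≠ -1) ∧ (e j ≠ 2 ∧ e j ≠ -1) ∧
      ∀ k, k ≠ i → k ≠ j → (e k = 2 ∨ e k = -1) := by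
  classical
  rw [Multiset.filter_map] at h
  have h0 : Multiset.map e (Finset.univ.filter (fun k => e k ≠ 2 ∧ e k ≠ -1)).val = {r, s} := by
    rw [← h]; rfl
  have hc : (Finset.univ.filter (fun k => e k ≠ 2 ∧ e k ≠ -1)).card = 2 := by
    have := congrArg Multiset.card h0
    rw [Multiset.card_map] at this
    exact this
  obtain ⟨i, j, hij, hs⟩ := Finset.card_eq_two.1 hc
  have hmem : ∀ k, (e k ≠ 2 ∧ e k ≠ -1) ↔ (k = i ∨ k = j) := by
    intro k
    have : k ∈ (Finset.univ.filter (fun k => e k ≠ 2 ∧ e k ≠ -1)) ↔ k ∈ ({i, j} : Finset V) := by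
      rw [hs]
    simpa using this
  rw [hs, Finset.insert_val_of_notMem (by simpa using hij)] at h0
  simp only [Finset.singleton_val, Multiset.map_cons, Multiset.map_singleton] at h0
  have hi := (hmem i).2 (Or.inl rfl)
  have hj := (hmem j).2 (Or.inr rfl)
  have hrest : ∀ k, k ≠ i → k ≠ j → (e k = 2 ∨ e k = -1) := by
    intro k hki hkj
    by_contra hc
    push Not at hc
    rcases (hmem k).1 hc with h | h
    · exact hki h
    · exact hkj h
  have h0' : ({e i, e j} : Multiset ℝ) = {r, s} := h0
  have hcase : (e i = r ∧ e j = s) ∨ (e i = s ∧ e j = r) := by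
    change (e i ::ₘ {e j}) = (r ::ₘ {s}) at h0'
    rw [Multiset.cons_eq_cons] at h0'
    rcases h0' with ⟨h1, h2⟩ | ⟨_, c, h1, h2⟩
    · left; exact ⟨h1, by simpa using h2⟩
    · right
      have m1 : r ∈ ({e j} : Multiset ℝ) := by rw [h1]; exact Multiset.mem_cons_self _ _
      have m2 : e i ∈ ({s} : Multiset ℝ) := by rw [h2]; exact Multiset.mem_cons_self _ _
      exact ⟨Multiset.mem_singleton.1 m2, (Multiset.mem_singleton.1 m1).symm⟩
  rcases hcase with ⟨h1, h2⟩ | ⟨h1, h2⟩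
  · exact ⟨i, j, hij, h1, h2, hi, hj, hrest⟩
  · exact ⟨j, i, hij.symm, h2, h1, hj, hi, fun k a b => hrest k b a⟩

/-- the case of a disjoint union of cliques -/
lemma cliques (G : SimpleGraph V) [DecidableRel G.Adj]
    (hA : (G.adjMatrix ℝ).IsHermitian) (i j : V) (hij : i ≠ j)
    (hi : hA.eigenvalues i ≠ 2 ∧ hA.eigenvalues i ≠ -1)
    (hj : hA.eigenvalues j ≠ 2 ∧ hA.eigenvalues j ≠ -1)
    (hk : ∀ k, k ≠ i → k ≠ j → (hA.eigenvalues k = 2 ∨ hA.eigenvalues k = -1))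
    (hcl : ∀ u v : V, u ≠ v → G.connectedComponentMk u = G.connectedComponentMk v → G.Adj u v) :
    ∃ c₁ c₂ : G.ConnectedComponent, c₁ ≠ c₂ ∧ c₁.supp.ncard ≠ 3 ∧ c₂.supp.ncard ≠ 3 ∧
        ∀ c : G.ConnectedComponent, c ≠ c₁ → c ≠ c₂ → c.supp.ncard = 3 := by
  classical
  letI : Fintype G.ConnectedComponent := Fintype.ofFinite _
  let B : Matrix V G.ConnectedComponent ℝ :=
    Matrix.of fun v c => if G.connectedComponentMk v = c then 1 else 0
  have hBB : B * B.transpose = G.adjMatrix ℝ + 1 := by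
    ext u v
    rw [Matrix.mul_apply]
    simp only [B, Matrix.of_apply, Matrix.transpose_apply, Matrix.add_apply,
      SimpleGraph.adjMatrix_apply, Matrix.one_apply]
    simp only [ite_mul, one_mul, zero_mul, Finset.sum_ite_eq, Finset.mem_univ, if_true]
    by_cases huv : u = v
    · subst huv; simp
    · have : G.connectedComponentMk v = G.connectedComponentMk u ↔ G.Adj u v :=
        ⟨fun h => hcl u v huv h.symm, fun h => (SimpleGraph.ConnectedComponent.eq.2 h.reachable).symm⟩
      simp [this, huv]
  have hBtB : B.transpose * B = Matrix.diagonal (fun c : G.ConnectedComponent => (c.supp.ncard : ℝ)) := by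
    ext c d
    rw [Matrix.mul_apply]
    simp only [B, Matrix.of_apply, Matrix.transpose_apply, Matrix.diagonal_apply]
    by_cases hcd : c = d
    · subst hcd
      simp only [ite_mul, one_mul, zero_mul, if_true]
      rw [Finset.sum_congr rfl (g := fun x => if G.connectedComponentMk x = c then (1:ℝ) else 0)
        (by intro x _; split_ifs <;> rfl), Finset.sum_boole, Set.ncard_eq_toFinset_card']
      congr 2
      ext x; simp
    · rw [if_neg hcd]
      apply Finset.sum_eq_zero
      intro x _
      by_cases hx : G.connectedComponentMk x = c
      · simp [hx, hcd]
      · simp [hx]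
  obtain ⟨U, hU, hU', hAU⟩ := spec_exists hA
  have hdiag : G.adjMatrix ℝ + 1 = U * Matrix.diagonal (fun k => hA.eigenvalues k + 1) * U.transpose := by
    have : Matrix.diagonal (fun k => hA.eigenvalues k + 1)
        = Matrix.diagonal hA.eigenvalues + (1 : Matrix V V ℝ) := by
      rw [← Matrix.diagonal_one, Matrix.diagonal_add]
    rw [this, mul_add, add_mul, mul_one, hU, ← hAU]
  have hch := Matrix.charpoly_mul_comm' B B.transpose
  rw [hBB, hdiag, Matrix.charpoly_mul_comm, ← mul_assoc, hU', one_mul, hBtB,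
    Matrix.charpoly_diagonal, Matrix.charpoly_diagonal] at hch
  have hn1 : (∏ k, (X - C (hA.eigenvalues k + 1)) : ℝ[X]) ≠ 0 :=
    Finset.prod_ne_zero_iff.2 fun k _ => X_sub_C_ne_zero _
  have hn2 : (∏ c : G.ConnectedComponent, (X - C (c.supp.ncard : ℝ)) : ℝ[X]) ≠ 0 :=
    Finset.prod_ne_zero_iff.2 fun k _ => X_sub_C_ne_zero _
  have hr := congrArg (fun p : ℝ[X] => (p.roots.filter (fun x => x ≠ 3 ∧ x ≠ 0)).card) hch
  rw [roots_mul (mul_ne_zero (pow_ne_zero _ X_ne_zero) hn1),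
    roots_mul (mul_ne_zero (pow_ne_zero _ X_ne_zero) hn2), roots_prod _ _ hn1, roots_prod _ _ hn2] at hr
  simp only [roots_X_sub_C, roots_X_pow, Multiset.filter_add, Multiset.card_add,
    Multiset.bind_singleton, Multiset.filter_map, Multiset.card_map] at hr
  have hz : ∀ n : ℕ, Multiset.filter (fun x : ℝ => x ≠ 3 ∧ x ≠ 0) (n • {0}) = 0 := by
    intro n
    rw [Multiset.filter_eq_nil]
    intro a ha
    have := Multiset.mem_of_mem_nsmul ha
    simp at this
    simp [this]
  rw [hz, hz, Multiset.card_zero, zero_add, zero_add] at hr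
  have hL : (Finset.univ.filter (fun k => hA.eigenvalues k + 1 ≠ 3 ∧ hA.eigenvalues k + 1 ≠ 0)).card = 2 := by
    refine Eq.trans ?_ (Finset.card_pair hij)
    congr 1
    ext k
    simp only [Finset.mem_filter, Finset.mem_univ, true_and, Finset.mem_insert, Finset.mem_singleton]
    constructor
    · rintro ⟨h1, h2⟩
      by_contra hc
      push Not at hc
      rcases hk k hc.1 hc.2 with h | h
      · apply h1; rw [h]; norm_num
      · apply h2; rw [h]; norm_num
    · have aux : ∀ x : ℝ, x ≠ 2 ∧ x ≠ -1 → x + 1 ≠ 3 ∧ x + 1 ≠ 0 := by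
        rintro x ⟨h1, h2⟩
        exact ⟨fun h => h1 (by linarith), fun h => h2 (by linarith)⟩
      rintro (rfl | rfl)
      · exact aux _ hi
      · exact aux _ hj
  have hR : (Finset.univ.filter (fun c : G.ConnectedComponent =>
      ((c.supp.ncard : ℝ) ≠ 3 ∧ (c.supp.ncard : ℝ) ≠ 0))).card = 2 := by
    refine Eq.trans ?_ hL
    exact hr.symm
  obtain ⟨c₁, c₂, h12, hs⟩ := Finset.card_eq_two.1 hR
  have hmem : ∀ c : G.ConnectedComponent, c.supp.ncard ≠ 3 ↔ (c = c₁ ∨ c = c₂) := by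
    intro c
    have h1 : c ∈ (Finset.univ.filter (fun c : G.ConnectedComponent =>
      ((c.supp.ncard : ℝ) ≠ 3 ∧ (c.supp.ncard : ℝ) ≠ 0))) ↔ c ∈ ({c₁, c₂} : Finset _) := by rw [hs]
    have hne : c.supp.ncard ≠ 0 := by
      have := (Set.ncard_pos (Set.toFinite c.supp)).2 c.nonempty_supp
      omega
    simp only [Finset.mem_filter, Finset.mem_univ, true_and, Finset.mem_insert,
      Finset.mem_singleton] at h1
    rw [← h1]
    constructor
    · intro h; exact ⟨by exact_mod_cast h, by exact_mod_cast hne⟩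
    · rintro ⟨h, _⟩; exact_mod_cast h
  refine ⟨c₁, c₂, h12, (hmem c₁).2 (Or.inl rfl), (hmem c₂).2 (Or.inr rfl), ?_⟩
  intro c h1 h2
  by_contra hc
  rcases (hmem c).1 hc with h | h
  · exact h1 h
  · exact h2 h

lemma trans_adj (G : SimpleGraph V) (h : ∀ u v w, G.Adj v u → G.Adj v w → u ≠ w → G.Adj u w) :
    ∀ u v : V, u ≠ v → G.connectedComponentMk u = G.connectedComponentMk v → G.Adj u v := by
  intro u v huv hc
  obtain ⟨p⟩ := SimpleGraph.ConnectedComponent.eq.1 hc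
  induction p with
  | nil => exact absurd rfl huv
  | @cons a b c hab q ih =>
    by_cases hbc : b = c
    · subst hbc; exact hab
    · exact h a b c hab.symm (ih hbc (SimpleGraph.ConnectedComponent.eq.2 q.reachable)) huv

theorem main_aux (G : SimpleGraph V) [DecidableRel G.Adj] (r s : ℝ) (hrs : s ≤ r)
    (h : (G.adjMatrix ℝ).charpoly.roots.filter (fun μ => μ ≠ 2 ∧ μ ≠ -1) = {r, s}) :
    (2 < r ∧ s < -1) ∨
    ((∀ u v : V, u ≠ v → G.connectedComponentMk u = G.connectedComponentMk v → G.Adj u v) ∧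
      ∃ c₁ c₂ : G.ConnectedComponent, c₁ ≠ c₂ ∧ c₁.supp.ncard ≠ 3 ∧ c₂.supp.ncard ≠ 3 ∧
        ∀ c : G.ConnectedComponent, c ≠ c₁ → c ≠ c₂ → c.supp.ncard = 3) := by
  have hA : (G.adjMatrix ℝ).IsHermitian := by
    rw [Matrix.IsHermitian, Matrix.conjTranspose_eq_transpose_of_trivial]
    exact G.transpose_adjMatrix
  rw [hA.roots_charpoly_eq_eigenvalues] at h
  obtain ⟨i, j, hij, hir, hjs, hi, hj, hk⟩ := pair_of_filter hA.eigenvalues r s h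
  by_cases ht : ∀ u v w, G.Adj v u → G.Adj v w → u ≠ w → G.Adj u w
  · right
    exact ⟨trans_adj G ht, cliques G hA i j hij hi hj hk (trans_adj G ht)⟩
  left
  push Not at ht
  obtain ⟨v₁, v₀, v₂, h1, h2, hne, hna⟩ := ht
  obtain ⟨U, hU, hU', hAU⟩ := spec_exists hA
  set e := hA.eigenvalues with he
  have hUone : ∀ a b, ∑ k, U a k * U b k = if a = b then 1 else 0 := by
    intro a b
    have := congrFun (congrFun hU a) b
    rw [Matrix.mul_apply, Matrix.one_apply] at this
    exact this
  have hA1 : ∀ a b, (if G.Adj a b then (1:ℝ) else 0) = ∑ k, e k * (U a k * U b k) := by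
    intro a b
    rw [← conj_diag_apply, ← hAU, SimpleGraph.adjMatrix_apply]
  have hA2 : ∀ a b, (cmn G a b : ℝ) = ∑ k, e k ^ 2 * (U a k * U b k) := by
    intro a b
    rw [← conj_diag_apply, ← sq_apply]
    have : G.adjMatrix ℝ * G.adjMatrix ℝ
        = U * Matrix.diagonal (fun k => e k ^ 2) * U.transpose := by
      have h3 : Matrix.diagonal (fun k => e k ^ 2) = Matrix.diagonal e * Matrix.diagonal e := by
        rw [Matrix.diagonal_mul_diagonal]; congr 1; ext k; ring
      rw [h3]
      calc G.adjMatrix ℝ * G.adjMatrix ℝ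
          = (U * Matrix.diagonal e * U.transpose) * (U * Matrix.diagonal e * U.transpose) := by
            rw [← hAU]
        _ = U * Matrix.diagonal e * (U.transpose * U) * Matrix.diagonal e * U.transpose := by
            simp only [mul_assoc]
        _ = _ := by rw [hU', mul_one]; simp only [mul_assoc]
    rw [this]
  have hq : ∀ x : V → ℝ, ∑ a, x a * ∑ b ∈ G.neighborFinset a, x b
      = ∑ k, e k * (∑ a, x a * U a k) ^ 2 := by
    intro x
    rw [← conj_diag_quad, ← hAU]
    apply Finset.sum_congr rfl
    intro a _
    rw [← SimpleGraph.adjMatrix_mulVec_apply]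
    rfl
  have hone : ∀ x : V → ℝ, ∑ a, x a ^ 2 = ∑ k, (∑ a, x a * U a k) ^ 2 := by
    intro x
    have := conj_diag_quad U (fun _ => 1) x
    rw [Matrix.diagonal_one, mul_one, hU] at this
    simp only [one_mul, Matrix.one_apply, ite_mul, zero_mul, Finset.sum_ite_eq,
      Finset.mem_univ, if_true] at this
    rw [← this]
    apply Finset.sum_congr rfl
    intro a _; ring
  have hs : s < -1 := by
    by_contra hc
    push Not at hc
    have hall : ∀ k, -1 ≤ e k := by
      intro k
      by_cases hki : k = i
      · rw [hki, hir]; linarith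
      by_cases hkj : k = j
      · rw [hkj, hjs]; linarith
      rcases hk k hki hkj with h | h <;> rw [h]; norm_num
    have hquad : ∀ x : V → ℝ, 0 ≤ ∑ a, x a * ∑ b ∈ G.neighborFinset a, x b + ∑ a, x a ^ 2 := by
      intro x
      rw [hq, hone, ← Finset.sum_add_distrib]
      apply Finset.sum_nonneg
      intro k _
      have := mul_nonneg (by linarith [hall k] : 0 ≤ e k + 1) (sq_nonneg (∑ a, x a * U a k))
      linarith
    let x : V → ℝ := fun a => (if a = v₁ then 1 else 0) + (if a = v₂ then 1 else 0)
      - (if a = v₀ then 1 else 0)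
    have hx := hquad x
    have e1 : ∀ a, ∑ b ∈ G.neighborFinset a, x b = (if G.Adj a v₁ then 1 else 0)
        + (if G.Adj a v₂ then 1 else 0) - (if G.Adj a v₀ then 1 else 0) := by
      intro a
      simp only [x, Finset.sum_add_distrib, Finset.sum_sub_distrib, Finset.sum_ite_eq',
        SimpleGraph.mem_neighborFinset]
    simp only [e1] at hx
    have e2 : ∀ g : V → ℝ, ∑ a, x a * g a = g v₁ + g v₂ - g v₀ := by
      intro g
      simp only [x, add_mul, sub_mul, Finset.sum_add_distrib, Finset.sum_sub_distrib, ite_mul,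
        one_mul, zero_mul, Finset.sum_ite_eq', Finset.mem_univ, if_true]
    have e3 : ∑ a, x a ^ 2 = 3 := by
      simp only [sq, e2]
      simp [x, hne, hne.symm, h1.ne, h1.ne', h2.ne, h2.ne']
      norm_num
    rw [e2, e3] at hx
    have hna' : ¬ G.Adj v₂ v₁ := fun h => hna h.symm
    simp [h1, h2, h1.symm, h2.symm, hna, hna'] at hx
    norm_num at hx
  refine ⟨?_, hs⟩
  by_contra hr2
  push Not at hr2
  have hle : ∀ k, e k ≤ 2 := by
    intro k
    by_cases hki : k = i
    · rw [hki, hir]; linarith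
    by_cases hkj : k = j
    · rw [hkj, hjs]; linarith
    rcases hk k hki hkj with h | h <;> rw [h]; norm_num
  refine core G (-((r - 2) * (r + 1))) ((s - 2) * (s + 1)) (by nlinarith) (fun a => U a i)
    (fun a => U a j) ?_ ?_ v₁ v₀ v₂ h1 h2 hne hna
  · intro a b
    have : (if a = b then (2:ℝ) else 0) = ∑ k, 2 * (U a k * U b k) := by
      rw [← Finset.mul_sum, hUone]; split_ifs <;> norm_num
    rw [hA1, hA2, this, ← Finset.sum_sub_distrib, ← Finset.sum_sub_distrib]
    rw [Finset.sum_eq_add_of_mem i j (Finset.mem_univ _) (Finset.mem_univ _) hij]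
    · rw [hir, hjs]; ring
    · rintro k _ ⟨hki, hkj⟩
      rcases hk k hki hkj with h | h <;> rw [h] <;> ring
  · intro x
    rw [hq, hone, Finset.mul_sum]
    apply Finset.sum_le_sum
    intro k _
    exact mul_le_mul_of_nonneg_right (hle k) (sq_nonneg _)

end spectral

/-- If the adjacency spectrum of a finite simple graph has exactly two entries `r ≥ s` (with
multiplicity) different from `2` and `-1`, then either `r > 2` and `s < -1`, or the graph is
a disjoint union of complete graphs exactly two of whose connected components are not
isomorphic to `K₃`. -/
theorem two_eigenvalues_not_two_or_neg_one {V : Type*} [Fintype V] [DecidableEq V]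
    (G : SimpleGraph V) (r s : ℝ) (hrs : s ≤ r)
    (h : (adjSpectrum G).filter (fun μ => μ ≠ 2 ∧ μ ≠ -1) = {r, s}) :
    (2 < r ∧ s < -1) ∨
    ((∀ u v : V, u ≠ v → G.connectedComponentMk u = G.connectedComponentMk v → G.Adj u v) ∧
      ∃ c₁ c₂ : G.ConnectedComponent, c₁ ≠ c₂ ∧ c₁.supp.ncard ≠ 3 ∧ c₂.supp.ncard ≠ 3 ∧
        ∀ c : G.ConnectedComponent, c ≠ c₁ → c ≠ c₂ → c.supp.ncard = 3) := by
  letI : DecidableRel G.Adj := Classical.decRel _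
  have h' : (G.adjMatrix ℝ).charpoly.roots.filter (fun μ => μ ≠ 2 ∧ μ ≠ -1) = {r, s} := by
    rw [← h]
    unfold adjSpectrum adjCharpoly
    congr
  exact main_aux G r s hrs h'
end

section
/- Let G be a finite simple graph whose adjacency spectrum consists of exactly two entries r > 2 and s < −1 (counted with multiplicity) together with entries all equal to 2 or −1. Then G has exactly one connected component in which every vertex has degree at least 3, and every other connected component of G is isomorphic to K₃. -/
open SimpleGraph Polynomial

/-- Coordinates of the spectral decomposition of the adjacency matrix. -/
lemma spectral_coords {V : Type*} [Fintype V] [DecidableEq V]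
    (G : SimpleGraph V) [DecidableRel G.Adj] :
    ∃ (l : V → ℝ) (U : V → V → ℝ),
      adjSpectrum G = Multiset.map l Finset.univ.val ∧
      (∀ u v, (if G.Adj u v then (1 : ℝ) else 0) = ∑ i, l i * (U u i * U v i)) ∧
      (∀ u v, ((G.neighborFinset u ∩ G.neighborFinset v).card : ℝ)
        = ∑ i, l i ^ 2 * (U u i * U v i)) ∧
      (∀ u v, (if u = v then (1 : ℝ) else 0) = ∑ i, U u i * U v i) ∧
      (∀ i, ∑ v, U v i * U v i = 1) := by
  have hA : (G.adjMatrix ℝ).IsHermitian := by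
    rw [Matrix.IsHermitian, Matrix.conjTranspose_eq_transpose_of_trivial]
    exact G.transpose_adjMatrix
  have hsp := hA.spectral_theorem
  rw [Unitary.conjStarAlgAut_apply] at hsp
  have h1 := Unitary.coe_mul_star_self hA.eigenvectorUnitary
  have h2 := Unitary.coe_star_mul_self hA.eigenvectorUnitary
  rw [Unitary.coe_star] at h1
  set U : Matrix V V ℝ := (hA.eigenvectorUnitary : Matrix V V ℝ) with hU
  set D : Matrix V V ℝ := Matrix.diagonal (RCLike.ofReal ∘ hA.eigenvalues) with hD
  have e1 : G.adjMatrix ℝ = U * D * star U := hsp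
  have e2 : G.adjMatrix ℝ * G.adjMatrix ℝ = U * (D * D) * star U := by
    calc G.adjMatrix ℝ * G.adjMatrix ℝ = (U * D * star U) * (U * D * star U) := by rw [← e1]
      _ = U * D * (star U * U) * D * star U := by simp only [Matrix.mul_assoc]
      _ = _ := by rw [h2]; simp only [Matrix.mul_assoc, Matrix.mul_one]
  refine ⟨hA.eigenvalues, fun v i => U v i, ?_, ?_, ?_, ?_, ?_⟩
  · have := hA.roots_charpoly_eq_eigenvalues
    unfold adjSpectrum adjCharpoly
    rw [Subsingleton.elim (Classical.decRel G.Adj) ‹DecidableRel G.Adj›]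
    exact this
  · intro u v
    have := congrFun (congrFun e1 u) v
    rw [SimpleGraph.adjMatrix_apply] at this
    rw [this, Matrix.mul_apply]
    refine Finset.sum_congr rfl fun i _ => ?_
    simp [hD, Matrix.mul_diagonal, Matrix.star_apply]
    ring
  · intro u v
    have := congrFun (congrFun e2 u) v
    have h3 : (G.adjMatrix ℝ * G.adjMatrix ℝ) u v
        = ((G.neighborFinset u ∩ G.neighborFinset v).card : ℝ) := by
      rw [SimpleGraph.adjMatrix_mul_apply]
      simp only [SimpleGraph.adjMatrix_apply]
      rw [Finset.sum_ite, Finset.sum_const_zero, add_zero, Finset.sum_const, nsmul_eq_mul, mul_one]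
      congr 2
      ext x
      simp [SimpleGraph.adj_comm]
    rw [← h3, this, Matrix.mul_apply]
    refine Finset.sum_congr rfl fun i _ => ?_
    simp [hD, Matrix.mul_diagonal, Matrix.star_apply]
    ring
  · intro u v
    have := congrFun (congrFun h1 u) v
    rw [Matrix.one_apply] at this
    rw [← this, Matrix.mul_apply]
    simp [Matrix.star_apply]
  · intro i
    have := congrFun (congrFun h2 i) i
    rw [Matrix.one_apply_eq] at this
    rw [← this, Matrix.mul_apply]
    simp [Matrix.star_apply]

/-- A vertex of degree two with zero row in `A² - A - 2I` lies in a triangle component. -/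
lemma triangle_of_row {V : Type*} [Fintype V] [DecidableEq V]
    (G : SimpleGraph V) [DecidableRel G.Adj] (v : V) (hd : G.degree v = 2)
    (hrow : ∀ u, u ≠ v → (G.neighborFinset v ∩ G.neighborFinset u).card
      = if G.Adj v u then 1 else 0) :
    ∃ x y, x ≠ v ∧ y ≠ v ∧ x ≠ y ∧ G.Adj v x ∧ G.Adj v y ∧ G.Adj x y ∧
      (G.connectedComponentMk v).supp = {v, x, y} := by
  obtain ⟨x, y, hxy, hN⟩ := Finset.card_eq_two.1 hd
  have hmem : ∀ z, G.Adj v z ↔ z = x ∨ z = y := by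
    intro z
    rw [← SimpleGraph.mem_neighborFinset, hN]; simp
  have hvx : G.Adj v x := (hmem x).2 (Or.inl rfl)
  have hvy : G.Adj v y := (hmem y).2 (Or.inr rfl)
  have hadj : G.Adj x y := by
    have := hrow x hvx.ne'
    rw [if_pos hvx] at this
    obtain ⟨z, hz⟩ := Finset.card_pos.1 (by omega : 0 < (G.neighborFinset v ∩ G.neighborFinset x).card)
    simp only [Finset.mem_inter, SimpleGraph.mem_neighborFinset] at hz
    rcases (hmem z).1 hz.1 with rfl | rfl
    · exact absurd hz.2 (G.irrefl)
    · exact hz.2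
  have hcl : ∀ w, G.Adj v w → ∀ z, G.Adj w z → z = v ∨ z = x ∨ z = y := by
    intro w hw z hz
    by_contra hcon
    push Not at hcon
    have h0 := hrow z hcon.1
    rw [if_neg (by rw [hmem]; tauto), Finset.card_eq_zero] at h0
    have : w ∈ G.neighborFinset v ∩ G.neighborFinset z := by
      simp [hw, hz.symm]
    rw [h0] at this
    simp at this
  refine ⟨x, y, hvx.ne', hvy.ne', hxy, hvx, hvy, hadj, ?_⟩
  ext w
  rw [SimpleGraph.ConnectedComponent.mem_supp_iff, SimpleGraph.ConnectedComponent.eq]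
  simp only [Set.mem_insert_iff, Set.mem_singleton_iff]
  constructor
  · intro h
    have h' := h.symm
    clear h
    rw [SimpleGraph.reachable_iff_reflTransGen] at h'
    induction h' with
    | refl => exact Or.inl rfl
    | tail _ hbc ih =>
      rcases ih with rfl | rfl | rfl
      · exact Or.inr ((hmem _).1 hbc)
      · exact hcl _ hvx _ hbc
      · exact hcl _ hvy _ hbc
  · rintro (rfl | rfl | rfl)
    · exact SimpleGraph.Reachable.refl _
    · exact hvx.symm.reachable
    · exact hvy.symm.reachable

/-- If the adjacency spectrum of a finite simple graph consists of exactly two entries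
`r > 2` and `s < -1` together with entries all equal to `2` or `-1`, then `G` has exactly
one connected component in which all vertices have degree at least `3`, and every other
connected component is isomorphic to `K₃` (it has `3` vertices and is complete). -/
theorem component_structure {V : Type*} [Fintype V] [DecidableEq V]
    (G : SimpleGraph V) [DecidableRel G.Adj] (r s : ℝ) (hr : 2 < r) (hs : s < -1)
    (h : (adjSpectrum G).filter (fun μ => μ ≠ 2 ∧ μ ≠ -1) = {r, s}) :
    ∃ c : G.ConnectedComponent,
      (∀ v ∈ c.supp, 3 ≤ G.degree v) ∧
      ∀ c' : G.ConnectedComponent, c' ≠ c →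
        c'.supp.ncard = 3 ∧ ∀ u v : V, u ∈ c'.supp → v ∈ c'.supp → u ≠ v → G.Adj u v := by
  classical
  obtain ⟨l, U, hspec, hA1, hA2, hI, hN⟩ := spectral_coords G
  rw [hspec] at h
  have hrs : r ≠ s := by linarith
  have hl : ∀ i, l i = 2 ∨ l i = -1 ∨ l i = r ∨ l i = s := by
    intro i
    by_contra hcon
    push Not at hcon
    have : l i ∈ (Multiset.map l Finset.univ.val).filter (fun μ => μ ≠ 2 ∧ μ ≠ -1) := by
      rw [Multiset.mem_filter]
      exact ⟨Multiset.mem_map_of_mem _ (Finset.mem_univ i), hcon.1, hcon.2.1⟩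
    rw [h] at this
    simp at this
    tauto
  have hcount : (Finset.univ.filter (fun i => r = l i)).card = 1 := by
    have h1 : Multiset.count r ((Multiset.map l Finset.univ.val).filter
        (fun μ => μ ≠ 2 ∧ μ ≠ -1)) = 1 := by
      rw [h]; simp [hrs]
    rw [Multiset.count_filter_of_pos (by constructor <;> linarith), Multiset.count_map] at h1
    exact h1
  obtain ⟨i0, hi0⟩ := Finset.card_eq_one.1 hcount
  have hi0' : ∀ i, r = l i ↔ i = i0 := by
    intro i
    have : i ∈ Finset.univ.filter (fun i => r = l i) ↔ i ∈ ({i0} : Finset V) := by rw [hi0]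
    simpa using this
  have hli0 : l i0 = r := ((hi0' i0).2 rfl).symm
  have hle : ∀ i, i ≠ i0 → l i ≤ 2 := by
    intro i hi
    rcases hl i with h1 | h1 | h1 | h1
    · linarith
    · linarith
    · exact absurd ((hi0' i).1 h1.symm) hi
    · linarith
  have hp : ∀ i, 0 ≤ l i ^ 2 - l i - 2 := by
    intro i
    rcases hl i with h1 | h1 | h1 | h1 <;> rw [h1]
    · norm_num
    · norm_num
    · nlinarith
    · nlinarith
  have hM : ∀ u v, ((G.neighborFinset u ∩ G.neighborFinset v).card : ℝ)
      - (if G.Adj u v then (1 : ℝ) else 0) - 2 * (if u = v then (1 : ℝ) else 0)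
      = ∑ i, (l i ^ 2 - l i - 2) * (U u i * U v i) := by
    intro u v
    rw [hA1, hA2, hI, Finset.mul_sum, ← Finset.sum_sub_distrib, ← Finset.sum_sub_distrib]
    exact Finset.sum_congr rfl fun i _ => by ring
  have hMd : ∀ v, (G.degree v : ℝ) - 2 = ∑ i, (l i ^ 2 - l i - 2) * (U v i * U v i) := by
    intro v
    rw [← hM]
    simp
  have hdeg2 : ∀ v, 2 ≤ G.degree v := by
    intro v
    have : (0 : ℝ) ≤ (G.degree v : ℝ) - 2 := by
      rw [hMd]
      exact Finset.sum_nonneg fun i _ => mul_nonneg (hp i) (mul_self_nonneg _)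
    have : (2 : ℝ) ≤ G.degree v := by linarith
    exact_mod_cast this
  have hzero : ∀ v, G.degree v = 2 → ∀ i, (l i ^ 2 - l i - 2) * U v i = 0 := by
    intro v hv i
    have h0 := hMd v
    rw [hv] at h0
    norm_num at h0
    have h1 := (Finset.sum_eq_zero_iff_of_nonneg
      (fun i _ => mul_nonneg (hp i) (mul_self_nonneg (U v i)))).1 h0.symm i (Finset.mem_univ i)
    rcases mul_eq_zero.1 h1 with h2 | h2
    · rw [h2, zero_mul]
    · rw [mul_self_eq_zero.1 h2, mul_zero]
  have htri : ∀ v, G.degree v = 2 → ∃ x y, x ≠ v ∧ y ≠ v ∧ x ≠ y ∧ G.Adj v x ∧ G.Adj v y ∧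
      G.Adj x y ∧ (G.connectedComponentMk v).supp = {v, x, y} := by
    intro v hv
    refine triangle_of_row G v hv fun u hu => ?_
    have h0 := hM v u
    rw [Finset.sum_eq_zero (fun i _ => by rw [← mul_assoc, hzero v hv i, zero_mul]),
      if_neg (Ne.symm hu)] at h0
    have h1 : ((G.neighborFinset v ∩ G.neighborFinset u).card : ℝ)
      = if G.Adj v u then (1 : ℝ) else 0 := by linarith
    split_ifs at h1 ⊢ <;> exact_mod_cast h1
  obtain ⟨w, hw⟩ : ∃ w, 3 ≤ G.degree w := by
    by_contra hcon
    push Not at hcon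
    have hU0 : ∀ v, U v i0 = 0 := by
      intro v
      have := hzero v (by have := hdeg2 v; have := hcon v; omega) i0
      rw [hli0] at this
      rcases mul_eq_zero.1 this with h2 | h2
      · nlinarith
      · exact h2
    have := hN i0
    simp [hU0] at this
  have htd : ∀ v, G.degree v = 2 → ∀ z ∈ (G.connectedComponentMk v).supp, G.degree z ≤ 2 := by
    intro v hv z hz
    obtain ⟨x, y, hxv, hyv, hxy, h1, h2, h3, hsup⟩ := htri v hv
    have hsub : G.neighborFinset z ⊆ ({v, x, y} : Finset V).erase z := by
      intro t ht
      rw [SimpleGraph.mem_neighborFinset] at ht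
      have : t ∈ (G.connectedComponentMk v).supp := by
        rw [SimpleGraph.ConnectedComponent.mem_supp_iff] at hz ⊢
        rw [← hz, SimpleGraph.ConnectedComponent.eq]
        exact ht.symm.reachable
      rw [hsup] at this
      simp only [Set.mem_insert_iff, Set.mem_singleton_iff] at this
      rw [Finset.mem_erase]
      exact ⟨ht.ne', by simpa using this⟩
    have hz' : z ∈ ({v, x, y} : Finset V) := by
      rw [hsup] at hz
      simpa using hz
    have hc := Finset.card_le_card hsub
    rw [Finset.card_erase_of_mem hz'] at hc
    have := Finset.card_le_three (a := v) (b := x) (c := y)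
    rw [SimpleGraph.card_neighborFinset_eq_degree] at hc
    omega
  have hbig : ∀ v ∈ (G.connectedComponentMk w).supp, 3 ≤ G.degree v := by
    intro v hv
    by_contra hcon
    have hv2 : G.degree v = 2 := by have := hdeg2 v; omega
    rw [SimpleGraph.ConnectedComponent.mem_supp_iff] at hv
    have := htd v hv2 w (by rw [SimpleGraph.ConnectedComponent.mem_supp_iff, hv])
    omega
  refine ⟨G.connectedComponentMk w, hbig, ?_⟩
  intro c' hc'
  by_cases hex : ∃ v ∈ c'.supp, G.degree v = 2
  · obtain ⟨v, hv, hv2⟩ := hex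
    obtain ⟨x, y, hxv, hyv, hxy, h1, h2, h3, hsup⟩ := htri v hv2
    rw [SimpleGraph.ConnectedComponent.mem_supp_iff] at hv
    rw [← hv, hsup]
    constructor
    · rw [Set.ncard_eq_three]
      exact ⟨v, x, y, hxv.symm, hyv.symm, hxy, rfl⟩
    · intro a b ha hb hab
      simp only [Set.mem_insert_iff, Set.mem_singleton_iff] at ha hb
      rcases ha with rfl | rfl | rfl <;> rcases hb with rfl | rfl | rfl <;>
        first
        | exact absurd rfl hab
        | assumption
        | (apply SimpleGraph.Adj.symm; assumption)
  · exfalso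
    push Not at hex
    have hbig' : ∀ v ∈ c'.supp, 3 ≤ G.degree v := fun v hv => by
      have := hdeg2 v; have := hex v hv; omega
    obtain ⟨w', hw'⟩ := c'.nonempty_supp
    have key : ∀ f : G.ConnectedComponent → ℝ,
        ∑ v, U v i0 * f (G.connectedComponentMk v) = 0 →
        (∑ v, f (G.connectedComponentMk v) ^ 2 * ((G.degree v : ℝ) - 2)) ≤ 0 := by
      intro f hf
      have e1 : ∀ u, f (G.connectedComponentMk u) ^ 2 * ((G.degree u : ℝ) - 2)
          = ∑ v, ((if G.Adj u v then (1 : ℝ) else 0) - 2 * (if u = v then (1 : ℝ) else 0))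
            * (f (G.connectedComponentMk u) * f (G.connectedComponentMk v)) := by
        intro u
        have e2 : ∀ v, ((if G.Adj u v then (1 : ℝ) else 0) - 2 * (if u = v then (1 : ℝ) else 0))
            * (f (G.connectedComponentMk u) * f (G.connectedComponentMk v))
            = f (G.connectedComponentMk u) ^ 2 *
              ((if G.Adj u v then (1 : ℝ) else 0) - 2 * (if u = v then (1 : ℝ) else 0)) := by
          intro v
          by_cases huv : G.Adj u v
          · rw [SimpleGraph.ConnectedComponent.connectedComponentMk_eq_of_adj huv]; ring
          · by_cases huv' : u = v
            · subst huv'; ring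
            · simp [huv, huv']
        rw [Finset.sum_congr rfl fun v _ => e2 v, ← Finset.mul_sum, Finset.sum_sub_distrib,
          ← Finset.mul_sum]
        congr 2
        · rw [← SimpleGraph.card_neighborFinset_eq_degree, SimpleGraph.neighborFinset_eq_filter]
          simp
        · simp
      have e3 : (∑ v, f (G.connectedComponentMk v) ^ 2 * ((G.degree v : ℝ) - 2))
          = ∑ i, (l i - 2) * (∑ v, U v i * f (G.connectedComponentMk v)) ^ 2 := by
        rw [Finset.sum_congr rfl fun u _ => e1 u]
        have e4 : ∀ u v, ((if G.Adj u v then (1 : ℝ) else 0) - 2 * (if u = v then (1 : ℝ) else 0))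
            * (f (G.connectedComponentMk u) * f (G.connectedComponentMk v))
            = ∑ i, (l i - 2) * ((U u i * f (G.connectedComponentMk u))
              * (U v i * f (G.connectedComponentMk v))) := by
          intro u v
          rw [hA1, hI, Finset.mul_sum, ← Finset.sum_sub_distrib, Finset.sum_mul]
          exact Finset.sum_congr rfl fun i _ => by ring
        simp_rw [e4]
        rw [Finset.sum_congr rfl fun u _ => Finset.sum_comm, Finset.sum_comm]
        refine Finset.sum_congr rfl fun i _ => ?_
        rw [sq, Finset.sum_mul_sum, Finset.mul_sum]
        exact Finset.sum_congr rfl fun u _ => by rw [Finset.mul_sum]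
      rw [e3]
      refine Finset.sum_nonpos fun i _ => ?_
      by_cases hi : i = i0
      · rw [hi, hf]; simp
      · exact mul_nonpos_of_nonpos_of_nonneg (by have := hle i hi; linarith) (sq_nonneg _)
    have key2 : ∀ f : G.ConnectedComponent → ℝ,
        ∑ v, U v i0 * f (G.connectedComponentMk v) = 0 →
        ∀ v, 3 ≤ G.degree v → f (G.connectedComponentMk v) = 0 := by
      intro f hf v hv
      have hnn : ∀ v ∈ Finset.univ,
          0 ≤ f (G.connectedComponentMk v) ^ 2 * ((G.degree v : ℝ) - 2) := by
        intro v _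
        have : (2 : ℝ) ≤ G.degree v := by exact_mod_cast hdeg2 v
        exact mul_nonneg (sq_nonneg _) (by linarith)
      have h0 := le_antisymm (key f hf) (Finset.sum_nonneg hnn)
      have h1 := (Finset.sum_eq_zero_iff_of_nonneg hnn).1 h0 v (Finset.mem_univ v)
      have : (3 : ℝ) ≤ G.degree v := by exact_mod_cast hv
      rcases mul_eq_zero.1 h1 with h2 | h2
      · exact pow_eq_zero_iff (by norm_num) |>.1 h2
      · linarith
    have hw'c : G.connectedComponentMk w' = c' := hw'
    set c := G.connectedComponentMk w with hc
    set S : G.ConnectedComponent → ℝ :=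
      fun d => ∑ v, U v i0 * (if G.connectedComponentMk v = d then 1 else 0) with hS
    have hlin : ∀ a b : ℝ, ∑ v, U v i0 * ((fun d => a * (if d = c then (1 : ℝ) else 0)
        + b * (if d = c' then (1 : ℝ) else 0)) (G.connectedComponentMk v))
        = a * S c + b * S c' := by
      intro a b
      simp only [hS, Finset.mul_sum, ← Finset.sum_add_distrib]
      exact Finset.sum_congr rfl fun v _ => by ring
    have hSc : S c' = 0 := by
      have := key2 (fun d => S c' * (if d = c then (1 : ℝ) else 0)
        + (-S c) * (if d = c' then (1 : ℝ) else 0)) ((hlin (S c') (-S c)).trans (by ring)) w hw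
      simpa [← hc, hc'.symm] using this
    have := key2 (fun d => 0 * (if d = c then (1 : ℝ) else 0)
        + 1 * (if d = c' then (1 : ℝ) else 0)) ((hlin 0 1).trans (by rw [hSc]; ring)) w' (hbig' w' hw')
    simp [hw'c] at this
end

section
/- Let G be a finite simple graph whose adjacency spectrum consists of exactly two entries r > 2 and s < −1 (counted with multiplicity) together with entries all equal to 2 or −1. If u and v are non-adjacent vertices of G such that every neighbor of u is also a neighbor of v, then deg(v) − deg(u) ≥ 5. -/
open SimpleGraph Polynomial

/-- If the adjacency spectrum of a finite simple graph consists of exactly two entries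
`r > 2` and `s < -1` together with entries all equal to `2` or `-1`, and `u`, `v` are
non-adjacent vertices such that every neighbor of `u` is also a neighbor of `v`, then
`deg v - deg u ≥ 5`. -/
theorem degree_gap_of_nested_neighborhoods {V : Type*} [Fintype V] [DecidableEq V]
    (G : SimpleGraph V) [DecidableRel G.Adj] (r s : ℝ) (hr : 2 < r) (hs : s < -1)
    (h : (adjSpectrum G).filter (fun μ => μ ≠ 2 ∧ μ ≠ -1) = {r, s})
    (u v : V) (huv : u ≠ v) (hadj : ¬ G.Adj u v)
    (hnbr : ∀ w : V, G.Adj u w → G.Adj v w) :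
    5 ≤ (G.degree v : ℤ) - (G.degree u : ℤ) := by
  classical
  set A : Matrix V V ℝ := G.adjMatrix ℝ with hA
  have hH : A.IsHermitian := by
    simp [Matrix.IsHermitian, hA]
  have hroots : adjSpectrum G = A.charpoly.roots := by
    unfold adjSpectrum adjCharpoly
    rw [hA]
    congr!
  -- every eigenvalue μ satisfies (μ - 2)(μ + 1) ≥ 0
  have hev : ∀ i, 0 ≤ hH.eigenvalues i * hH.eigenvalues i - hH.eigenvalues i - 2 := by
    intro i
    have hmem : hH.eigenvalues i ∈ adjSpectrum G := by
      rw [hroots, hH.roots_charpoly_eq_eigenvalues]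
      exact Multiset.mem_map.2 ⟨i, Finset.mem_univ i, rfl⟩
    generalize hH.eigenvalues i = μ at hmem ⊢
    by_cases h2 : μ = 2
    · subst h2; norm_num
    by_cases h1 : μ = -1
    · subst h1; norm_num
    have : μ ∈ (adjSpectrum G).filter (fun μ => μ ≠ 2 ∧ μ ≠ -1) :=
      Multiset.mem_filter.2 ⟨hmem, h2, h1⟩
    rw [h] at this
    have h3 : μ = r ∨ μ = s := by simpa using this
    rcases h3 with rfl | rfl <;> nlinarith
  have hM : (A * A - A - 2).PosSemidef := by
    have hD : (Matrix.diagonal (fun i =>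
        hH.eigenvalues i * hH.eigenvalues i - hH.eigenvalues i - 2)).PosSemidef :=
      Matrix.posSemidef_diagonal_iff.2 hev
    have hC := hD.mul_mul_conjTranspose_same (hH.eigenvectorUnitary : Matrix V V ℝ)
    have hE : Matrix.diagonal (fun i =>
        hH.eigenvalues i * hH.eigenvalues i - hH.eigenvalues i - 2) =
        Matrix.diagonal (RCLike.ofReal ∘ hH.eigenvalues)
          * Matrix.diagonal (RCLike.ofReal ∘ hH.eigenvalues)
          - Matrix.diagonal (RCLike.ofReal ∘ hH.eigenvalues) - (2 : Matrix V V ℝ) := by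
      rw [Matrix.diagonal_mul_diagonal, Matrix.diagonal_sub, ← Matrix.diagonal_ofNat,
        Matrix.diagonal_sub]
      rfl
    rw [hE, ← Matrix.star_eq_conjTranspose,
      ← Unitary.conjStarAlgAut_apply (S := ℝ), map_sub, map_sub, map_mul, map_ofNat,
      ← hH.spectral_theorem] at hC
    exact hC
  have hAuu : (A * A) u u = G.degree u := SimpleGraph.adjMatrix_mul_self_apply_self G u
  have hAvv : (A * A) v v = G.degree v := SimpleGraph.adjMatrix_mul_self_apply_self G v
  have hAuv : (A * A) u v = G.degree u := by
    rw [hA, SimpleGraph.adjMatrix_mul_apply]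
    rw [Finset.sum_congr rfl (g := fun _ => (1 : ℝ))]
    · simp
    · intro w hw
      have := hnbr w (by simpa using hw)
      simp [this.symm]
  have hMuu : (A * A - A - 2) u u = G.degree u - 2 := by
    rw [Matrix.sub_apply, Matrix.sub_apply, hAuu]; simp [hA, ← Matrix.diagonal_ofNat]
  have hMvv : (A * A - A - 2) v v = G.degree v - 2 := by
    rw [Matrix.sub_apply, Matrix.sub_apply, hAvv]; simp [hA, ← Matrix.diagonal_ofNat]
  have hMuv : (A * A - A - 2) u v = G.degree u := by
    rw [Matrix.sub_apply, Matrix.sub_apply, hAuv]; simp [hA, ← Matrix.diagonal_ofNat, hadj, huv]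
  have hMvu : (A * A - A - 2) v u = G.degree u := by
    rw [← hMuv]; simpa using (hM.1.apply u v)
  have hd := hM.diag_nonneg (i := u)
  have hdet := (hM.submatrix ![u, v]).det_nonneg
  rw [Matrix.det_fin_two] at hdet
  simp only [Matrix.submatrix_apply, Matrix.cons_val_zero, Matrix.cons_val_one] at hdet
  rw [hMuu, hMvv, hMuv, hMvu] at hdet
  rw [hMuu] at hd
  by_contra hlt
  have hle : (G.degree v : ℤ) ≤ G.degree u + 4 := by omega
  have hle' : (G.degree v : ℝ) ≤ G.degree u + 4 := by exact_mod_cast hle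
  nlinarith
end

section
/- Let G be a finite simple graph with adjacency matrix A, and suppose every eigenvalue λ of A satisfies λ ≥ 2 or λ ≤ −1 (so that A² − A − 2I is positive semi-definite). Then for any two non-adjacent vertices x and y of G, one has (deg(x) − 2)(deg(y) − 2) − d_{xy}² ≥ 0, where d_{xy} is the number of common neighbors of x and y. -/
open SimpleGraph Polynomial

theorem posSemidef_aux {V : Type*} [Fintype V] [DecidableEq V] (A : Matrix V V ℝ)
    (hA : A.IsHermitian) (h : ∀ μ ∈ A.charpoly.roots, 2 ≤ μ ∨ μ ≤ -1) :
    (A * A - A - (2 : ℝ) • (1 : Matrix V V ℝ)).PosSemidef := by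
  have hev : ∀ i, 2 ≤ hA.eigenvalues i ∨ hA.eigenvalues i ≤ -1 := by
    intro i
    apply h
    rw [hA.roots_charpoly_eq_eigenvalues]
    simp
  obtain ⟨U, D, hU, hD, hdec⟩ : ∃ (U : Matrix V V ℝ) (D : V → ℝ), star U * U = 1 ∧
      (∀ i, 2 ≤ D i ∨ D i ≤ -1) ∧ (U * star U = 1 ∧ A = U * Matrix.diagonal D * star U) := by
    refine ⟨hA.eigenvectorUnitary, hA.eigenvalues, by simp, hev, by simp, ?_⟩
    have := hA.spectral_theorem
    rw [Unitary.conjStarAlgAut_apply] at this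
    exact this
  obtain ⟨hU', hdec⟩ := hdec
  have key : A * A - A - (2 : ℝ) • (1 : Matrix V V ℝ)
      = U * Matrix.diagonal (fun i => D i * D i - D i - 2) * star U := by
    have e : Matrix.diagonal (fun i => D i * D i - D i - 2)
        = Matrix.diagonal D * Matrix.diagonal D - Matrix.diagonal D
          - (2 : ℝ) • (1 : Matrix V V ℝ) := by
      ext i j
      by_cases hij : i = j
      · subst hij; simp
      · simp [hij]
    have e2 : A * A = U * (Matrix.diagonal D * Matrix.diagonal D) * star U := by
      calc A * A = U * Matrix.diagonal D * (star U * U) * Matrix.diagonal D * star U := by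
            rw [hdec]; simp only [mul_assoc]
        _ = _ := by rw [hU]; simp only [mul_assoc, mul_one]
    rw [e, e2, mul_sub, mul_sub, sub_mul, sub_mul, Matrix.mul_smul, Matrix.smul_mul, mul_one, hU',
      ← hdec]
  rw [key]
  refine Matrix.PosSemidef.mul_mul_conjTranspose_same ?_ U
  refine Matrix.PosSemidef.diagonal ?_
  intro i
  change 0 ≤ D i * D i - D i - 2
  rcases hD i with h | h <;> nlinarith

/-- If every adjacency eigenvalue `λ` of a finite simple graph satisfies `λ ≥ 2` or
`λ ≤ -1` (so that `A² - A - 2I` is positive semi-definite), then for any two non-adjacent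
vertices `x` and `y` one has `(deg x - 2)(deg y - 2) - d_{xy}² ≥ 0`, where `d_{xy}` is the
number of common neighbors of `x` and `y`. -/
theorem nonadjacent_degree_inequality {V : Type*} [Fintype V] [DecidableEq V]
    (G : SimpleGraph V) [DecidableRel G.Adj]
    (h : ∀ μ ∈ adjSpectrum G, 2 ≤ μ ∨ μ ≤ -1)
    (x y : V) (hxy : x ≠ y) (hadj : ¬ G.Adj x y) :
    0 ≤ ((G.degree x : ℤ) - 2) * ((G.degree y : ℤ) - 2)
        - ((G.neighborFinset x ∩ G.neighborFinset y).card : ℤ) ^ 2 := by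
  have hA : (G.adjMatrix ℝ).IsHermitian := G.isHermitian_adjMatrix ℝ
  have hs : ∀ μ ∈ (G.adjMatrix ℝ).charpoly.roots, 2 ≤ μ ∨ μ ≤ -1 := by
    intro μ hμ
    apply h
    unfold adjSpectrum adjCharpoly
    convert hμ
  have hP := posSemidef_aux _ hA hs
  have hdet := (hP.submatrix ![x, y]).det_nonneg
  have hd : ∀ u v : V, (G.adjMatrix ℝ * G.adjMatrix ℝ) u v
      = ((G.neighborFinset u ∩ G.neighborFinset v).card : ℝ) := by
    intro u v
    rw [SimpleGraph.adjMatrix_mul_apply]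
    simp only [SimpleGraph.adjMatrix_apply, Finset.sum_boole]
    congr 2
    ext w
    simp [G.adj_comm w v]
  have hadj' : ¬ G.Adj y x := fun k => hadj k.symm
  rw [Matrix.det_fin_two] at hdet
  simp [-SimpleGraph.adjMatrix_mul_apply, -SimpleGraph.mul_adjMatrix_apply,
    Matrix.sub_apply, hd, hxy, hxy.symm, hadj, hadj',
    Finset.inter_comm (G.neighborFinset y)] at hdet
  have : (0 : ℝ) ≤ ((G.degree x : ℝ) - 2) * ((G.degree y : ℝ) - 2)
        - ((G.neighborFinset x ∩ G.neighborFinset y).card : ℝ) ^ 2 := by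
    rw [pow_two]; linarith
  exact_mod_cast this
end

section
/- Let G be a connected finite simple graph whose adjacency spectrum consists of exactly two entries r > 2 and s < −1 (counted with multiplicity) together with entries all equal to 2 or −1, and let C be a clique of G of maximum size. Then the vertex set of C can be partitioned into two nonempty subsets X and Y such that for every vertex v outside C, the set of neighbors of v inside C is equal to X, to Y, or to the empty set. -/
open SimpleGraph Polynomial

theorem spec_aux {V : Type*} [Fintype V] [DecidableEq V] (A : Matrix V V ℝ) (hA : A.IsHermitian)
    (r s : ℝ) (hr : 2 < r) (hs : s < -1)
    (h : A.charpoly.roots.filter (fun μ => μ ≠ 2 ∧ μ ≠ -1) = {r, s}) :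
    ∃ w : V → ℝ, ∀ f : V → ℝ, w ⬝ᵥ f = 0 → 0 ≤ f ⬝ᵥ ((A + 1).mulVec f) := by
  have h2 : A.charpoly.roots.filter (fun μ => μ < -1) = {s} := by
    have : A.charpoly.roots.filter (fun μ => μ < -1) =
        (A.charpoly.roots.filter (fun μ => μ ≠ 2 ∧ μ ≠ -1)).filter (fun μ => μ < -1) := by
      rw [Multiset.filter_filter]
      apply Multiset.filter_congr
      intro x _
      constructor
      · intro hx
        exact ⟨hx, by constructor <;> intro h <;> linarith⟩
      · exact fun hx => hx.1
    rw [this, h]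
    have e : ({r, s} : Multiset ℝ) = r ::ₘ {s} := rfl
    rw [e, Multiset.filter_cons_of_neg _ (by linarith), Multiset.filter_singleton, if_pos hs]
  rw [hA.roots_charpoly_eq_eigenvalues, Multiset.filter_map] at h2
  have h3 := congrArg Multiset.card h2
  rw [Multiset.card_map, Multiset.card_singleton, Multiset.card_eq_one] at h3
  obtain ⟨i0, hi0⟩ := h3
  have key : ∀ i, i ≠ i0 → -1 ≤ hA.eigenvalues i := by
    intro i hi
    by_contra hlt
    push Not at hlt
    have : i ∈ ({i0} : Multiset V) := by
      rw [← hi0, Multiset.mem_filter]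
      exact ⟨Finset.mem_univ i, by simpa using hlt⟩
    exact hi (by simpa using this)
  refine ⟨hA.eigenvectorBasis i0, fun f hf => ?_⟩
  have hb : ∀ i, (hA.eigenvectorBasis i : V → ℝ) ⬝ᵥ (A.mulVec f) =
      hA.eigenvalues i * ((hA.eigenvectorBasis i : V → ℝ) ⬝ᵥ f) := by
    intro i
    have hT : A.transpose = A := by
      ext i j
      simpa using hA.apply i j
    rw [Matrix.dotProduct_mulVec, ← Matrix.mulVec_transpose, hT, hA.mulVec_eigenvectorBasis]
    simp
  have hs := (hA.eigenvectorBasis).sum_inner_mul_inner (WithLp.toLp 2 f)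
    (WithLp.toLp 2 ((A + 1).mulVec f))
  have e1 : inner ℝ (WithLp.toLp 2 f : EuclideanSpace ℝ V) (WithLp.toLp 2 ((A + 1).mulVec f))
      = f ⬝ᵥ ((A + 1).mulVec f) := by
    simp [EuclideanSpace.inner_eq_star_dotProduct, dotProduct_comm]
  rw [← e1, ← hs]
  apply Finset.sum_nonneg
  intro i _
  have e2 : inner ℝ (WithLp.toLp 2 f) (hA.eigenvectorBasis i) =
      (hA.eigenvectorBasis i : V → ℝ) ⬝ᵥ f := by
    simp [EuclideanSpace.inner_eq_star_dotProduct]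
  have e3 : inner ℝ (hA.eigenvectorBasis i) (WithLp.toLp 2 ((A + 1).mulVec f)) =
      (hA.eigenvalues i + 1) * ((hA.eigenvectorBasis i : V → ℝ) ⬝ᵥ f) := by
    rw [EuclideanSpace.inner_eq_star_dotProduct, dotProduct_comm]
    simp only [star_trivial, Matrix.add_mulVec, Matrix.one_mulVec, dotProduct_add, hb]
    ring
  rw [e2, e3]
  by_cases hi : i = i0
  · subst hi
    rw [hf]; simp
  · have := key i hi
    nlinarith [mul_nonneg (by linarith : 0 ≤ hA.eigenvalues i + 1)
      (sq_nonneg ((hA.eigenvectorBasis i : V → ℝ) ⬝ᵥ f))]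

theorem tri_aux {V : Type*} [Fintype V] [DecidableEq V]
    (B : Matrix V V ℝ) (hB : ∀ i j, B i j = B j i) (w : V → ℝ)
    (hw : ∀ f : V → ℝ, w ⬝ᵥ f = 0 → 0 ≤ f ⬝ᵥ (B.mulVec f))
    (x y z u v : V) (hxx : B x x = 1) (hyy : B y y = 1) (hzz : B z z = 1)
    (hxy : B x y = 1) (hxz : B x z = 1) (hyz : B y z = 1)
    (huu : B u u = 1) (hvv : B v v = 1) (huv : B u v = 0 ∨ B u v = 1)
    (hdet : (B u x - B u y) * (B v x - B v z) - (B u x - B u z) * (B v x - B v y) ≠ 0) :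
    False := by
  -- the two parameter family
  obtain ⟨c, d, hcd, hlin⟩ : ∃ c d : ℝ, (c ≠ 0 ∨ d ≠ 0) ∧
      c * (w x - w y - (B u x - B u y) / 2 * w u - (B v x - B v y) / 2 * w v) +
      d * (w x - w z - (B u x - B u z) / 2 * w u - (B v x - B v z) / 2 * w v) = 0 := by
    generalize w x - w y - (B u x - B u y) / 2 * w u - (B v x - B v y) / 2 * w v = p
    generalize w x - w z - (B u x - B u z) / 2 * w u - (B v x - B v z) / 2 * w v = q
    by_cases hp : p = 0
    · exact ⟨1, 0, Or.inl one_ne_zero, by simp [hp]⟩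
    · exact ⟨q, -p, Or.inr (neg_ne_zero.mpr hp), by ring⟩
  obtain ⟨a, ha⟩ : ∃ a, a = c * (B u x - B u y) + d * (B u x - B u z) := ⟨_, rfl⟩
  obtain ⟨b, hb⟩ : ∃ b, b = c * (B v x - B v y) + d * (B v x - B v z) := ⟨_, rfl⟩
  have hab : 0 < a ^ 2 + b ^ 2 := by
    by_contra hcon
    have ha0 : a = 0 := by nlinarith [sq_nonneg a, sq_nonneg b]
    have hb0 : b = 0 := by nlinarith [sq_nonneg a, sq_nonneg b]
    rcases hcd with hc | hd
    · apply hdet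
      apply mul_left_cancel₀ hc
      linear_combination (B v x - B v z) * (ha0 - ha) - (B u x - B u z) * (hb0 - hb)
    · apply hdet
      apply mul_left_cancel₀ hd
      linear_combination (B u x - B u y) * (hb0 - hb) - (B v x - B v y) * (ha0 - ha)
  have hf := hw (Pi.single x (c + d) + Pi.single y (-c) + Pi.single z (-d) +
    Pi.single u (-a / 2) + Pi.single v (-b / 2)) (by
      simp only [dotProduct_add, dotProduct_single]
      linear_combination hlin - w u / 2 * ha - w v / 2 * hb)
  simp only [Matrix.mulVec_add, dotProduct_add, add_dotProduct, single_dotProduct,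
    Matrix.mulVec_single, Pi.smul_apply, MulOpposite.smul_eq_mul_unop, MulOpposite.unop_op,
    Matrix.col_apply] at hf
  rw [hB y x, hB z x, hB z y, hB x u, hB y u, hB z u, hB x v, hB y v, hB z v, hB v u,
    hxx, hyy, hzz, hxy, hxz, hyz, huu, hvv] at hf
  rcases huv with e | e <;> rw [e] at hf
  · have : 0 ≤ -(3 / 4) * (a ^ 2 + b ^ 2) := by
      refine hf.trans (le_of_eq ?_)
      linear_combination a * ha + b * hb
    linarith
  · have : 0 ≤ -(3 / 4) * (a ^ 2 + b ^ 2) + a * b / 2 := by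
      refine hf.trans (le_of_eq ?_)
      linear_combination a * ha + b * hb
    nlinarith [sq_nonneg (a - b)]

/-- Let `G` be a connected finite simple graph whose adjacency spectrum consists of exactly
two entries `r > 2` and `s < -1` together with entries all equal to `2` or `-1`, and let `C`
be a clique of maximum size. Then `C` can be partitioned into two nonempty subsets `X` and
`Y` such that the neighborhood of any vertex outside `C` intersects `C` in `X`, in `Y`, or
in the empty set. -/
theorem max_clique_partition {V : Type*} [Fintype V] [DecidableEq V]
    (G : SimpleGraph V) [DecidableRel G.Adj] (hconn : G.Connected)
    (r s : ℝ) (hr : 2 < r) (hs : s < -1)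
    (h : (adjSpectrum G).filter (fun μ => μ ≠ 2 ∧ μ ≠ -1) = {r, s})
    (C : Finset V) (hC : G.IsClique (C : Set V))
    (hmax : ∀ D : Finset V, G.IsClique (D : Set V) → D.card ≤ C.card) :
    ∃ X Y : Finset V, X.Nonempty ∧ Y.Nonempty ∧ Disjoint X Y ∧ X ∪ Y = C ∧
      ∀ v : V, v ∉ C →
        G.neighborFinset v ∩ C = X ∨ G.neighborFinset v ∩ C = Y ∨
          G.neighborFinset v ∩ C = ∅ := by
  classical
  set A := G.adjMatrix ℝ with hAdef
  have hA : A.IsHermitian := by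
    ext i j
    simp [hAdef, SimpleGraph.adjMatrix_apply, G.adj_comm]
  have h' : A.charpoly.roots.filter (fun μ => μ ≠ 2 ∧ μ ≠ -1) = {r, s} := by
    rw [← h]
    unfold adjSpectrum adjCharpoly
    rw [hAdef]
    congr!
  obtain ⟨w, hw⟩ := spec_aux A hA r s hr hs h'
  have hV : 2 ≤ Fintype.card V := by
    have h1 : Multiset.card (A.charpoly.roots.filter (fun μ => μ ≠ 2 ∧ μ ≠ -1)) = 2 := by
      rw [h']; rfl
    have h2 := Multiset.card_le_card
      (Multiset.filter_le (fun μ : ℝ => μ ≠ 2 ∧ μ ≠ -1) A.charpoly.roots)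
    have h3 := A.charpoly.card_roots'
    rw [Matrix.charpoly_natDegree_eq_dim] at h3
    omega
  have hC2 : 1 < C.card := by
    have : Nontrivial V := Fintype.one_lt_card_iff_nontrivial.mp hV
    obtain ⟨a⟩ := hconn.nonempty
    obtain ⟨b, hb⟩ := hconn.preconnected.exists_adj_of_nontrivial a
    have := hmax {a, b} (by
      intro p hp q hq hpq
      simp at hp hq
      rcases hp with rfl | rfl <;> rcases hq with rfl | rfl <;> simp_all [G.adj_comm])
    rw [Finset.card_pair hb.ne] at this
    omega
  have hmaxv : ∀ v, v ∉ C → ∃ t ∈ C, ¬ G.Adj v t := by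
    intro v hv
    by_contra hcon
    push Not at hcon
    have := hmax (insert v C) (by
      rw [Finset.coe_insert]
      exact hC.insert (fun b hb _ => hcon b hb))
    rw [Finset.card_insert_of_notMem hv] at this
    omega
  have hBoff : ∀ i j, i ≠ j → (A + 1) i j = if G.Adj i j then 1 else 0 := by
    intro i j hij
    simp [hAdef, Matrix.one_apply, hij, SimpleGraph.adjMatrix_apply]
  have hBd : ∀ i, (A + 1) i i = 1 := by
    intro i
    simp [hAdef]
  have hBs : ∀ i j, (A + 1) i j = (A + 1) j i := by
    intro i j
    simp [hAdef, Matrix.one_apply, SimpleGraph.adjMatrix_apply, G.adj_comm, eq_comm]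
  have hBC : ∀ i ∈ C, ∀ j ∈ C, (A + 1) i j = 1 := by
    intro i hi j hj
    by_cases hij : i = j
    · subst hij; exact hBd i
    · rw [hBoff i j hij, if_pos (hC hi hj hij)]
  have tri : ∀ x ∈ C, ∀ y ∈ C, ∀ z ∈ C, ∀ u, u ∉ C → ∀ v, v ∉ C →
      ((if G.Adj u x then (1 : ℝ) else 0) - (if G.Adj u y then 1 else 0)) *
        ((if G.Adj v x then 1 else 0) - (if G.Adj v z then 1 else 0)) -
      ((if G.Adj u x then 1 else 0) - (if G.Adj u z then 1 else 0)) *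
        ((if G.Adj v x then 1 else 0) - (if G.Adj v y then 1 else 0)) ≠ 0 → False := by
    intro x hx y hy z hz u hu v hv hdet
    have ne : ∀ {p q}, p ∉ C → q ∈ C → p ≠ q := by
      rintro p q hp hq rfl
      exact hp hq
    refine tri_aux (A + 1) hBs w hw x y z u v (hBd _) (hBd _) (hBd _) (hBC _ hx _ hy)
      (hBC _ hx _ hz) (hBC _ hy _ hz) (hBd _) (hBd _) ?_ ?_
    · by_cases huv : u = v
      · subst huv; exact Or.inr (hBd _)
      · rw [hBoff _ _ huv]
        split_ifs <;> simp
    · rwa [hBoff _ _ (ne hu hx), hBoff _ _ (ne hu hy), hBoff _ _ (ne hu hz),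
        hBoff _ _ (ne hv hx), hBoff _ _ (ne hv hy), hBoff _ _ (ne hv hz)]
  by_cases hex : ∃ u, u ∉ C ∧ ∃ t ∈ C, G.Adj u t
  · obtain ⟨u, hu, t1, ht1, hut1⟩ := hex
    obtain ⟨t2, ht2, hut2⟩ := hmaxv u hu
    refine ⟨G.neighborFinset u ∩ C, C \ G.neighborFinset u, ⟨t1, by simp [ht1, hut1]⟩,
      ⟨t2, by simp [ht2, hut2]⟩, ?_, ?_, ?_⟩
    · rw [Finset.disjoint_left]
      intro a ha hb
      simp at ha hb
      exact hb.2 ha.1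
    · ext a
      simp
      tauto
    · intro v hv
      by_contra hcon
      push Not at hcon
      obtain ⟨h1, h2, h3⟩ := hcon
      have k1 : ∃ t ∈ C, ¬ (G.Adj v t ↔ G.Adj u t) := by
        by_contra hc
        push Not at hc
        apply h1
        ext a
        simp only [Finset.mem_inter, SimpleGraph.mem_neighborFinset]
        constructor <;> rintro ⟨p, q⟩ <;> have := hc a q <;> tauto
      have k2 : ∃ t ∈ C, (G.Adj v t ↔ G.Adj u t) := by
        by_contra hc
        push Not at hc
        apply h2
        ext a
        simp only [Finset.mem_inter, Finset.mem_sdiff, SimpleGraph.mem_neighborFinset]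
        constructor <;> rintro ⟨p, q⟩
        · have := hc a q; tauto
        · have := hc a p; tauto
      have k3 : ∃ t ∈ C, G.Adj v t := by
        obtain ⟨t, ht⟩ := h3
        simp at ht
        exact ⟨t, ht.2, ht.1⟩
      obtain ⟨t3, ht3, q3⟩ := k3
      obtain ⟨t4, ht4, q4⟩ := hmaxv v hv
      obtain ⟨t5, ht5, q5⟩ := k1
      obtain ⟨t6, ht6, q6⟩ := k2
      by_cases a1 : G.Adj v t1 <;> by_cases a2 : G.Adj v t2
      · exact tri t1 ht1 t2 ht2 t4 ht4 u hu v hv (by simp [*])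
      · refine tri t1 ht1 t2 ht2 t5 ht5 u hu v hv ?_
        by_cases G.Adj u t5 <;> by_cases G.Adj v t5 <;> simp_all
      · refine tri t1 ht1 t2 ht2 t6 ht6 u hu v hv ?_
        by_cases G.Adj u t6 <;> by_cases G.Adj v t6 <;> simp_all
      · exact tri t1 ht1 t2 ht2 t3 ht3 u hu v hv (by simp [*])
  · push Not at hex
    obtain ⟨a, ha, b, hb, hab⟩ := Finset.one_lt_card.mp hC2
    refine ⟨{a}, C \ {a}, ⟨a, by simp⟩, ⟨b, by simp [hb, hab.symm]⟩, Finset.disjoint_sdiff, ?_, ?_⟩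
    · exact Finset.union_sdiff_of_subset (by simpa using ha)
    · intro v hv
      right; right
      ext t
      simp only [Finset.mem_inter, SimpleGraph.mem_neighborFinset, Finset.notMem_empty, iff_false]
      rintro ⟨p, q⟩
      exact hex v hv t q p
end
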